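/- arXiv:1201.5756 — 6 statements merged into one kernel-verified Lean document; each statement's English description precedes it below -/
import Mathlib

section
/- Let V_n be a sequence of finite subsets of ℤ^d with |V_n| → ∞, and let q_n ≥ 0 with δ_n := e^{-2q_n}. Assume (a) lim_{n→∞} δ_n² |V_n| = 0, and (b) there exists δ₀ > 0 such that sup_n sup_{δ∈[0,δ₀]} (1/|V_n|) Var_π[ Σ_{i∈V_n} φ_i/(1+δφ_i) ] < ∞, both for π = π^{PCA} (on volume V_n with parameter δ) and for π = π̃ (on volume V_n with parameter δ). Then the total variation distance ‖π^{PCA}_n − π^G_n‖_TV between the PCA stationary measure on V_n with parameter δ_n and the Gibbs measure on V_n tends to 0 as n → ∞. -/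
open Finset

section defs

/-- The spin value of a Boolean: `true ↦ 1`, `false ↦ -1`. -/
def spin (b : Bool) : ℝ := if b then 1 else -1

variable {ι : Type*} [Fintype ι] [DecidableEq ι]

/-- The configuration `σ` with the spin at site `j` flipped. -/
def flipAt (σ : ι → Bool) (j : ι) : ι → Bool := Function.update σ j (!σ j)

/-- `ρ_j(g) = max_σ |g(σ) - g(σ^j)|`. -/
noncomputable def rho (j : ι) (g : (ι → Bool) → ℝ) : ℝ :=
  Finset.univ.sup' Finset.univ_nonempty fun σ => |g σ - g (flipAt σ j)|

/-- Expectation of `g` under the (finitely supported) measure `π`. -/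
noncomputable def Emean {α : Type*} [Fintype α] (π g : α → ℝ) : ℝ := ∑ x, π x * g x

/-- Variance of `g` under `π`. -/
noncomputable def Var {α : Type*} [Fintype α] (π g : α → ℝ) : ℝ :=
  Emean π (fun x => g x ^ 2) - (Emean π g) ^ 2

/-- Covariance of `f` and `g` under `π`. -/
noncomputable def Cov {α : Type*} [Fintype α] (π f g : α → ℝ) : ℝ :=
  Emean π (fun x => f x * g x) - Emean π f * Emean π g

/-- Total variation distance `(1/2) Σ_x |μ(x) - ν(x)|`. -/
noncomputable def tv {α : Type*} [Fintype α] (μ ν : α → ℝ) : ℝ :=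
  (1 / 2) * ∑ x, |μ x - ν x|

/-- `h_i(σ) = -Σ_j J_{ij} σ_j`. -/
noncomputable def hfun (J : ι → ι → ℝ) (i : ι) (σ : ι → Bool) : ℝ :=
  -∑ j, J i j * spin (σ j)

/-- `h_{i,l}(σ) = -Σ_{j ≠ l} J_{ij} σ_j`. -/
noncomputable def hil (J : ι → ι → ℝ) (i l : ι) (σ : ι → Bool) : ℝ :=
  -∑ j ∈ Finset.univ.erase l, J i j * spin (σ j)

/-- `H(σ) = -Σ_{i,j} J_{ij} σ_i σ_j` (equals `-Σ_{i≠j}` since `J_{ii}=0`). -/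
noncomputable def Ham (J : ι → ι → ℝ) (σ : ι → Bool) : ℝ :=
  -∑ i, ∑ j, J i j * spin (σ i) * spin (σ j)

/-- The Gibbs measure `π^G(σ) = e^{-H(σ)} / Σ_τ e^{-H(τ)}`. -/
noncomputable def piG (J : ι → ι → ℝ) (σ : ι → Bool) : ℝ :=
  Real.exp (-Ham J σ) / ∑ τ : ι → Bool, Real.exp (-Ham J τ)

/-- `φ_i(σ) = exp(-2 Σ_j J_{ij} σ_i σ_j)`. -/
noncomputable def phi (J : ι → ι → ℝ) (i : ι) (σ : ι → Bool) : ℝ :=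
  Real.exp (-2 * ∑ j, J i j * spin (σ i) * spin (σ j))

/-- `f_δ(σ) = Π_i (1 + δ φ_i(σ))`. -/
noncomputable def fδ (J : ι → ι → ℝ) (δ : ℝ) (σ : ι → Bool) : ℝ :=
  ∏ i, (1 + δ * phi J i σ)

/-- The PCA stationary measure `π^{PCA}(σ) = π^G(σ) f(σ) / π^G(f)`. -/
noncomputable def piPCA (J : ι → ι → ℝ) (δ : ℝ) (σ : ι → Bool) : ℝ :=
  piG J σ * fδ J δ σ / Emean (piG J) (fδ J δ)

/-- The measure `π̃(σ) = π^G(σ) f(σ)² / π^G(f²)`. -/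
noncomputable def piTilde (J : ι → ι → ℝ) (δ : ℝ) (σ : ι → Bool) : ℝ :=
  piG J σ * (fδ J δ σ) ^ 2 / Emean (piG J) (fun τ => (fδ J δ τ) ^ 2)

/-- `Σ_{i∈V} φ_i/(1 + δ φ_i)`. -/
noncomputable def Gsum (J : ι → ι → ℝ) (δ : ℝ) (σ : ι → Bool) : ℝ :=
  ∑ i, phi J i σ / (1 + δ * phi J i σ)

/-- The conditional probability `π(σ_i = 1 | σ restricted to V∖{i})`. -/
noncomputable def condProb (π : (ι → Bool) → ℝ) (i : ι) (σ : ι → Bool) : ℝ :=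
  π (Function.update σ i true) /
    (π (Function.update σ i true) + π (Function.update σ i false))

/-- The Dobrushin coefficient `γ_{ij} = max_σ |π(σ_i=1|σ_{∖i}) - π(σ_i=1|σ^j_{∖i})|`. -/
noncomputable def dobr (π : (ι → Bool) → ℝ) (i j : ι) : ℝ :=
  Finset.univ.sup' Finset.univ_nonempty fun σ =>
    |condProb π i σ - condProb π i (flipAt σ j)|

/-- `ψ_{i,δ}` from the local-specification computation. -/
noncomputable def psi (J : ι → ι → ℝ) (δ : ℝ) (i : ι) (σ : ι → Bool) : ℝ :=
  (1 / 2) *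
    (Real.log ((1 + δ * Real.exp (-2 * hfun J i σ)) / (1 + δ * Real.exp (2 * hfun J i σ))) +
      ∑ l ∈ Finset.univ.erase i,
        Real.log
          ((1 + δ * Real.exp (-2 * J i l * spin (σ l) - 2 * spin (σ l) * hil J i l σ)) /
            (1 + δ * Real.exp (2 * J i l * spin (σ l) - 2 * spin (σ l) * hil J i l σ))))

/-- The pair Hamiltonian `H(σ,σ') = Σ_i [h_i(σ) σ'_i + q(1 - σ_i σ'_i)]`. -/
noncomputable def Hpair (J : ι → ι → ℝ) (q : ℝ) (σ σ' : ι → Bool) : ℝ :=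
  ∑ i, (hfun J i σ * spin (σ' i) + q * (1 - spin (σ i) * spin (σ' i)))

/-- `Z_σ = Σ_τ e^{-H(σ,τ)}`. -/
noncomputable def Zconf (J : ι → ι → ℝ) (q : ℝ) (σ : ι → Bool) : ℝ :=
  ∑ τ : ι → Bool, Real.exp (-Hpair J q σ τ)

/-- The PCA transition probability `P^{PCA}_{σ,σ'} = e^{-H(σ,σ')}/Z_σ`. -/
noncomputable def Ppca (J : ι → ι → ℝ) (q : ℝ) (σ σ' : ι → Bool) : ℝ :=
  Real.exp (-Hpair J q σ σ') / Zconf J q σ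

/-- The PCA stationary measure written as `π^{PCA}(σ) = Z_σ / Σ_τ Z_τ`. -/
noncomputable def piPCAq (J : ι → ι → ℝ) (q : ℝ) (σ : ι → Bool) : ℝ :=
  Zconf J q σ / ∑ τ : ι → Bool, Zconf J q τ

end defs

/-- Restriction of an interaction on an infinite site space to a finite volume `V`. -/
def Jres {α : Type*} (J : α → α → ℝ) (V : Finset α) : ↥V → ↥V → ℝ :=
  fun a b => J a.1 b.1

section helpers

variable {ι : Type*} [Fintype ι] [DecidableEq ι]

omit [DecidableEq ι] in
theorem one_add_mul_phi_pos (J : ι → ι → ℝ) (i : ι) (σ : ι → Bool) {t : ℝ} (ht : 0 ≤ t) :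
    0 < 1 + t * phi J i σ := by
  have : 0 < phi J i σ := Real.exp_pos _
  positivity

omit [DecidableEq ι] in
theorem fδ_pos (J : ι → ι → ℝ) (σ : ι → Bool) {t : ℝ} (ht : 0 ≤ t) : 0 < fδ J t σ :=
  Finset.prod_pos fun i _ => one_add_mul_phi_pos J i σ ht

theorem sum_exp_neg_Ham_pos (J : ι → ι → ℝ) :
    0 < ∑ τ : ι → Bool, Real.exp (-Ham J τ) :=
  Finset.sum_pos (fun _ _ => Real.exp_pos _) Finset.univ_nonempty

theorem piG_pos (J : ι → ι → ℝ) (σ : ι → Bool) : 0 < piG J σ :=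
  div_pos (Real.exp_pos _) (sum_exp_neg_Ham_pos J)

theorem sum_piG (J : ι → ι → ℝ) : ∑ σ, piG J σ = 1 := by
  simp only [piG, ← Finset.sum_div]
  exact div_self (sum_exp_neg_Ham_pos J).ne'

theorem Emean_piG_fδ_pos (J : ι → ι → ℝ) {t : ℝ} (ht : 0 ≤ t) :
    0 < Emean (piG J) (fδ J t) :=
  Finset.sum_pos (fun σ _ => mul_pos (piG_pos J σ) (fδ_pos J σ ht)) Finset.univ_nonempty

theorem piPCA_pos (J : ι → ι → ℝ) (σ : ι → Bool) {t : ℝ} (ht : 0 ≤ t) :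
    0 < piPCA J t σ :=
  div_pos (mul_pos (piG_pos J σ) (fδ_pos J σ ht)) (Emean_piG_fδ_pos J ht)

theorem sum_piPCA (J : ι → ι → ℝ) {t : ℝ} (ht : 0 ≤ t) : ∑ σ, piPCA J t σ = 1 := by
  simp only [piPCA, ← Finset.sum_div]
  exact div_self (Emean_piG_fδ_pos J ht).ne'

theorem piPCA_zero (J : ι → ι → ℝ) : piPCA J 0 = piG J := by
  ext σ
  simp [piPCA, fδ, Emean, sum_piG]

omit [DecidableEq ι] in
theorem hasDerivAt_fδ (J : ι → ι → ℝ) (σ : ι → Bool) {t : ℝ} (ht : 0 ≤ t) :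
    HasDerivAt (fun s => fδ J s σ) (fδ J t σ * Gsum J t σ) t := by
  classical
  have h := HasDerivAt.fun_finsetProd (u := Finset.univ) (x := t)
    (f := fun i s => 1 + s * phi J i σ) (f' := fun i => phi J i σ)
    fun i _ => by simpa using ((hasDerivAt_id t).mul_const (phi J i σ)).const_add 1
  refine h.congr_deriv ?_
  rw [Gsum, Finset.mul_sum]
  refine Finset.sum_congr rfl fun i _ => ?_
  have hi := (one_add_mul_phi_pos J i σ ht).ne'
  rw [fδ, ← Finset.mul_prod_erase _ _ (Finset.mem_univ i), smul_eq_mul]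
  field_simp

/-- The PCA measure evolves in `t` by the centred score `Gsum`. -/
theorem hasDerivAt_piPCA (J : ι → ι → ℝ) (σ : ι → Bool) {t : ℝ} (ht : 0 ≤ t) :
    HasDerivAt (fun s => piPCA J s σ)
      (piPCA J t σ * (Gsum J t σ - Emean (piPCA J t) (Gsum J t))) t := by
  have hnum := (hasDerivAt_fδ J σ ht).const_mul (piG J σ)
  have hden : HasDerivAt (fun s => Emean (piG J) (fδ J s))
      (∑ τ, piG J τ * (fδ J t τ * Gsum J t τ)) t :=
    HasDerivAt.fun_sum fun τ _ => (hasDerivAt_fδ J τ ht).const_mul (piG J τ)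
  have hZ := (Emean_piG_fδ_pos J ht).ne'
  refine (hnum.div hden hZ).congr_deriv ?_
  have hmean : Emean (piPCA J t) (Gsum J t) =
      (∑ τ, piG J τ * (fδ J t τ * Gsum J t τ)) / Emean (piG J) (fδ J t) := by
    rw [Emean, Finset.sum_div]
    exact Finset.sum_congr rfl fun τ _ => by rw [piPCA]; ring
  rw [hmean, piPCA]
  field_simp

end helpers

/-- The mean absolute deviation is at most the standard deviation. -/
theorem sum_mul_abs_sub_Emean_le_sqrt_Var {α : Type*} [Fintype α] (π g : α → ℝ)
    (hπ : ∀ x, 0 ≤ π x) (hsum : ∑ x, π x = 1) :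
    ∑ x, π x * |g x - Emean π g| ≤ √(Var π g) := by
  have hVar : Var π g = ∑ x, π x * (g x - Emean π g) ^ 2 := by
    have h : ∑ x, π x * (g x - Emean π g) ^ 2 =
        ∑ x, π x * g x ^ 2 - 2 * Emean π g * ∑ x, π x * g x + Emean π g ^ 2 * ∑ x, π x := by
      rw [Finset.mul_sum, Finset.mul_sum, ← Finset.sum_sub_distrib, ← Finset.sum_add_distrib]
      exact Finset.sum_congr rfl fun x _ => by ring
    rw [h, hsum, Var]
    change Emean π (fun x => g x ^ 2) - _ =
      Emean π (fun x => g x ^ 2) - 2 * Emean π g * Emean π g + _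
    ring
  refine Real.le_sqrt_of_sq_le ?_
  have h := Finset.sum_sq_le_sum_mul_sum_of_sq_le_mul Finset.univ
    (r := fun x => π x * |g x - Emean π g|) (f := π)
    (g := fun x => π x * (g x - Emean π g) ^ 2) (fun x _ => hπ x)
    (fun x _ => mul_nonneg (hπ x) (sq_nonneg _))
    (fun x _ => le_of_eq (by rw [mul_pow, sq_abs]; ring))
  rwa [hsum, one_mul, ← hVar] at h

/-- Integrating the score along `[0, δ]` bounds the distance from `π^{PCA}` to `π^G`. -/
theorem tv_piPCA_piG_le {ι : Type*} [Fintype ι] [DecidableEq ι] (J : ι → ι → ℝ) {δ B : ℝ}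
    (hδ : 0 ≤ δ)
    (hB : ∀ t ∈ Set.Icc 0 δ, Var (piPCA J t) (Gsum J t) ≤ B) :
    tv (piPCA J δ) (piG J) ≤ 1 / 2 * (√B * δ) := by
  set s : (ι → Bool) → ℝ := fun σ => SignType.sign (piPCA J δ σ - piPCA J 0 σ) with hs
  have hs1 : ∀ σ, |s σ| ≤ 1 := fun σ => by
    rcases lt_trichotomy (piPCA J δ σ - piPCA J 0 σ) 0 with h | h | h <;> simp [hs, h]
  have key := Convex.norm_image_sub_le_of_norm_hasDerivWithin_le (C := √B)
    (f := fun t => ∑ σ, s σ * piPCA J t σ)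
    (f' := fun t =>
      ∑ σ, s σ * (piPCA J t σ * (Gsum J t σ - Emean (piPCA J t) (Gsum J t))))
    (fun t ht => (HasDerivAt.fun_sum fun σ _ =>
      (hasDerivAt_piPCA J σ ht.1).const_mul (s σ)).hasDerivWithinAt)
    (fun t ht => ?_) (convex_Icc 0 δ) (Set.left_mem_Icc.2 hδ) (Set.right_mem_Icc.2 hδ)
  · rw [sub_zero, Real.norm_of_nonneg hδ] at key
    rw [tv, ← piPCA_zero]
    gcongr
    refine le_trans (le_of_eq ?_) ((le_abs_self _).trans key)
    rw [← Finset.sum_sub_distrib]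
    refine Finset.sum_congr rfl fun σ _ => ?_
    rw [← mul_sub, hs, sign_mul_self]
  · have hpos := fun σ => (piPCA_pos J σ ht.1).le
    calc ‖∑ σ, s σ * (piPCA J t σ * (Gsum J t σ - Emean (piPCA J t) (Gsum J t)))‖
        ≤ ∑ σ, piPCA J t σ * |Gsum J t σ - Emean (piPCA J t) (Gsum J t)| := by
          refine (norm_sum_le _ _).trans (Finset.sum_le_sum fun σ _ => ?_)
          rw [Real.norm_eq_abs, abs_mul, abs_mul, abs_of_nonneg (hpos σ)]
          exact mul_le_of_le_one_left (mul_nonneg (hpos σ) (abs_nonneg _)) (hs1 σ)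
      _ ≤ √(Var (piPCA J t) (Gsum J t)) :=
          sum_mul_abs_sub_Emean_le_sqrt_Var _ _ hpos (sum_piPCA J ht.1)
      _ ≤ √B := Real.sqrt_le_sqrt (hB t ht)

/-- If `|Vₙ| → ∞`, `δₙ = e^{-2qₙ}`, `δₙ²|Vₙ| → 0`, and the per-site variances of
`Σ_i φ_i/(1+δφ_i)` under `π^{PCA}` and `π̃` are bounded uniformly in `n` and `δ ∈ [0,δ₀]`,
then `‖π^{PCA}ₙ - π^Gₙ‖_TV → 0`. -/
theorem pca_tv_convergence {d : ℕ}
    (J : (Fin d → ℤ) → (Fin d → ℤ) → ℝ)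
    (hsym : ∀ i j, J i j = J j i)
    (hdiag : ∀ i, J i i = 0)
    (hsumm : ∀ i, Summable fun j => |J i j|)
    (Jbar : ℝ) (hJbar : ∀ i, ∑' j, |J i j| ≤ Jbar)
    (V : ℕ → Finset (Fin d → ℤ))
    (hV : Filter.Tendsto (fun n => ((V n).card : ℝ)) Filter.atTop Filter.atTop)
    (q : ℕ → ℝ) (hq : ∀ n, 0 ≤ q n)
    (δ : ℕ → ℝ) (hδ : ∀ n, δ n = Real.exp (-2 * q n))
    (ha : Filter.Tendsto (fun n => (δ n) ^ 2 * ((V n).card : ℝ)) Filter.atTop (nhds 0))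
    (hb : ∃ δ₀ > (0 : ℝ), ∃ M : ℝ, ∀ n : ℕ, ∀ t ∈ Set.Icc (0 : ℝ) δ₀,
        (1 / ((V n).card : ℝ)) *
            Var (piPCA (Jres J (V n)) t) (Gsum (Jres J (V n)) t) ≤ M ∧
        (1 / ((V n).card : ℝ)) *
            Var (piTilde (Jres J (V n)) t) (Gsum (Jres J (V n)) t) ≤ M) :
    Filter.Tendsto (fun n => tv (piPCA (Jres J (V n)) (δ n)) (piG (Jres J (V n))))
      Filter.atTop (nhds 0) := by
  obtain ⟨δ₀, hδ₀, M, hM⟩ := hb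
  have hpos : ∀ n, 0 < δ n := fun n => hδ n ▸ Real.exp_pos _
  have hlim : Filter.Tendsto
      (fun n => 1 / 2 * √(M * (δ n ^ 2 * ((V n).card : ℝ)))) Filter.atTop (nhds 0) := by
    simpa using ((ha.const_mul M).sqrt).const_mul (1 / 2 : ℝ)
  refine squeeze_zero' (Filter.Eventually.of_forall fun n => ?_) ?_ hlim
  · exact mul_nonneg (by norm_num) (Finset.sum_nonneg fun _ _ => abs_nonneg _)
  · filter_upwards [hV.eventually_ge_atTop 1, ha.eventually_lt_const (pow_pos hδ₀ 2)]
      with n hn hsmall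
    have hle : δ n ≤ δ₀ := by
      refine (pow_le_pow_iff_left₀ (hpos n).le hδ₀.le two_ne_zero).1 ?_
      exact (le_mul_of_one_le_right (sq_nonneg _) hn).trans hsmall.le
    refine (tv_piPCA_piG_le _ (B := ((V n).card : ℝ) * M) (hpos n).le fun t ht => ?_).trans_eq ?_
    · have h := (hM n t ⟨ht.1, ht.2.trans hle⟩).1
      rwa [one_div, inv_mul_le_iff₀ (by linarith)] at h
    · rw [show M * (δ n ^ 2 * ((V n).card : ℝ)) = ((V n).card : ℝ) * M * δ n ^ 2 by ring,
        Real.sqrt_mul' _ (sq_nonneg _), Real.sqrt_sq (hpos n).le]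
end

section
/- There exist δ* > 0 and C < ∞, depending only on J̄, such that for every finite V ⊂ ℤ^d and every δ ∈ [0, δ*], one has sup_{i∈V} Σ_{j∈V} ρ_j(ψ_{i,δ}) ≤ C δ. (In particular sup_i Σ_j ρ_j(ψ_{i,δ}) → 0 as δ → 0, uniformly in V.) -/
open Finset

theorem abs_log_sub_log_le_abs_sub {x y : ℝ} (hx : 1 ≤ x) (hy : 1 ≤ y) :
    |Real.log x - Real.log y| ≤ |x - y| := by
  have key : ∀ {u v : ℝ}, 1 ≤ u → 1 ≤ v → Real.log u - Real.log v ≤ |u - v| := by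
    intro u v hu hv
    have hv0 : 0 < v := by linarith
    rw [← Real.log_div (by linarith) hv0.ne']
    calc Real.log (u / v) ≤ u / v - 1 := Real.log_le_sub_one_of_pos (by positivity)
      _ = (u - v) / v := by field_simp
      _ ≤ |u - v| / v := by gcongr; exact le_abs_self _
      _ ≤ |u - v| := div_le_self (abs_nonneg _) hv
  rw [abs_le]
  have h := key hy hx
  rw [abs_sub_comm] at h
  exact ⟨by linarith, key hx hy⟩

theorem abs_exp_sub_exp_le {x y B : ℝ} (hx : x ≤ B) (hy : y ≤ B) :
    |Real.exp x - Real.exp y| ≤ Real.exp B * |x - y| := by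
  have key : ∀ {u v : ℝ}, u ≤ B → Real.exp u - Real.exp v ≤ Real.exp B * |u - v| := by
    intro u v hu
    have h1 : Real.exp v = Real.exp u * Real.exp (v - u) := by
      rw [← Real.exp_add]; ring_nf
    have h2 := Real.add_one_le_exp (v - u)
    calc Real.exp u - Real.exp v = Real.exp u * (1 - Real.exp (v - u)) := by rw [h1]; ring
      _ ≤ Real.exp u * |u - v| := by
        gcongr
        linarith [le_abs_self (u - v)]
      _ ≤ Real.exp B * |u - v| := by gcongr
  rw [abs_le]
  have h := key (u := y) (v := x) hy
  rw [abs_sub_comm] at h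
  exact ⟨by linarith, key hx⟩

theorem one_le_one_add_mul_exp {δ : ℝ} (hδ : 0 ≤ δ) (x : ℝ) : 1 ≤ 1 + δ * Real.exp x := by
  have := mul_nonneg hδ (Real.exp_pos x).le
  linarith

/-- The log-ratio `log ((1 + δ e^{x-a}) / (1 + δ e^{x+a}))`, of which `psi` is a sum. -/
noncomputable def logRatio (δ a x : ℝ) : ℝ :=
  Real.log ((1 + δ * Real.exp (x - a)) / (1 + δ * Real.exp (x + a)))

theorem logRatio_eq_sub {δ : ℝ} (hδ : 0 ≤ δ) (a x : ℝ) :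
    logRatio δ a x =
      Real.log (1 + δ * Real.exp (x - a)) - Real.log (1 + δ * Real.exp (x + a)) :=
  Real.log_div (by linarith [one_le_one_add_mul_exp hδ (x - a)])
    (by linarith [one_le_one_add_mul_exp hδ (x + a)])

theorem abs_log_one_add_mul_exp_sub_le {δ x y B : ℝ} (hδ : 0 ≤ δ) (hx : x ≤ B) (hy : y ≤ B) :
    |Real.log (1 + δ * Real.exp x) - Real.log (1 + δ * Real.exp y)| ≤
      δ * (Real.exp B * |x - y|) := by
  refine (abs_log_sub_log_le_abs_sub (one_le_one_add_mul_exp hδ x)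
    (one_le_one_add_mul_exp hδ y)).trans ?_
  rw [show 1 + δ * Real.exp x - (1 + δ * Real.exp y) = δ * (Real.exp x - Real.exp y) by ring,
    abs_mul, abs_of_nonneg hδ]
  gcongr
  exact abs_exp_sub_exp_le hx hy

theorem abs_logRatio_le {δ a x B : ℝ} (hδ : 0 ≤ δ) (ha : |a| ≤ B) (hx : |x| ≤ B) :
    |logRatio δ a x| ≤ 2 * δ * Real.exp B ^ 2 * |a| := by
  rw [logRatio_eq_sub hδ]
  obtain ⟨ha1, ha2⟩ := abs_le.mp ha
  obtain ⟨hx1, hx2⟩ := abs_le.mp hx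
  refine (abs_log_one_add_mul_exp_sub_le (B := B + B) hδ (by linarith) (by linarith)).trans_eq ?_
  rw [show x - a - (x + a) = -(2 * a) by ring, abs_neg, abs_mul, abs_two, Real.exp_add]
  ring

/-- Variation of `logRatio` in its first argument at `x = 0`. -/
theorem abs_logRatio_zero_sub_le {δ a b B : ℝ} (hδ : 0 ≤ δ) (ha : |a| ≤ B) (hb : |b| ≤ B) :
    |logRatio δ a 0 - logRatio δ b 0| ≤ 2 * δ * Real.exp B * |a - b| := by
  rw [logRatio_eq_sub hδ, logRatio_eq_sub hδ]
  obtain ⟨ha1, ha2⟩ := abs_le.mp ha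
  obtain ⟨hb1, hb2⟩ := abs_le.mp hb
  have h1 := abs_log_one_add_mul_exp_sub_le (x := 0 - a) (y := 0 - b) (B := B) hδ
    (by linarith) (by linarith)
  have h2 := abs_log_one_add_mul_exp_sub_le (x := 0 + a) (y := 0 + b) (B := B) hδ
    (by linarith) (by linarith)
  rw [show 0 - a - (0 - b) = -(a - b) by ring, abs_neg] at h1
  rw [show 0 + a - (0 + b) = a - b by ring] at h2
  rw [sub_sub_sub_comm]
  refine (abs_sub _ _).trans ?_
  linarith

/-- Mixed second-order bound: the variation of `logRatio` in `x` carries a factor `|a|`. -/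
theorem abs_logRatio_sub_le {δ a x y B : ℝ} (hδ : 0 ≤ δ) (ha : |a| ≤ B) (hx : |x| ≤ B)
    (hy : |y| ≤ B) :
    |logRatio δ a x - logRatio δ a y| ≤ 2 * δ * Real.exp B ^ 2 * |a| * |x - y| := by
  have h1 := one_le_one_add_mul_exp hδ (x - a)
  have h2 := one_le_one_add_mul_exp hδ (x + a)
  have h3 := one_le_one_add_mul_exp hδ (y - a)
  have h4 := one_le_one_add_mul_exp hδ (y + a)
  have hsplit : logRatio δ a x - logRatio δ a y =
      Real.log ((1 + δ * Real.exp (x - a)) * (1 + δ * Real.exp (y + a))) -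
        Real.log ((1 + δ * Real.exp (x + a)) * (1 + δ * Real.exp (y - a))) := by
    rw [logRatio_eq_sub hδ, logRatio_eq_sub hδ, Real.log_mul (by linarith) (by linarith),
      Real.log_mul (by linarith) (by linarith)]
    ring
  have hprod : (1 + δ * Real.exp (x - a)) * (1 + δ * Real.exp (y + a)) -
      (1 + δ * Real.exp (x + a)) * (1 + δ * Real.exp (y - a)) =
      δ * ((Real.exp x - Real.exp y) * (Real.exp (-a) - Real.exp a)) := by
    simp only [sub_eq_add_neg, Real.exp_add]
    ring
  rw [hsplit]
  refine (abs_log_sub_log_le_abs_sub (one_le_mul_of_one_le_of_one_le h1 h4)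
    (one_le_mul_of_one_le_of_one_le h2 h3)).trans ?_
  rw [hprod, abs_mul, abs_mul, abs_of_nonneg hδ]
  have e1 := abs_exp_sub_exp_le (abs_le.mp hx).2 (abs_le.mp hy).2
  have e2 := abs_exp_sub_exp_le (x := -a) (y := a) (B := B) (by linarith [(abs_le.mp ha).1])
    (abs_le.mp ha).2
  rw [show -a - a = -(2 * a) by ring, abs_neg, abs_mul, abs_two] at e2
  calc δ * (|Real.exp x - Real.exp y| * |Real.exp (-a) - Real.exp a|)
      ≤ δ * ((Real.exp B * |x - y|) * (Real.exp B * (2 * |a|))) := by gcongr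
    _ = 2 * δ * Real.exp B ^ 2 * |a| * |x - y| := by ring

theorem abs_spin (b : Bool) : |spin b| = 1 := by
  cases b <;> simp [spin]

theorem abs_sum_mul_spin_le {ι : Type*} [Fintype ι] {K : ℝ} {c : ι → ℝ} (hK : ∑ k, |c k| ≤ K)
    (S : Finset ι) (σ : ι → Bool) :
    |∑ k ∈ S, c k * spin (σ k)| ≤ K := by
  calc |∑ k ∈ S, c k * spin (σ k)| ≤ ∑ k ∈ S, |c k * spin (σ k)| := abs_sum_le_sum_abs _ _
    _ = ∑ k ∈ S, |c k| := by simp [abs_mul, abs_spin]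
    _ ≤ ∑ k, |c k| := sum_le_sum_of_subset_of_nonneg (subset_univ S) fun _ _ _ => abs_nonneg _
    _ ≤ K := hK

section Flip

variable {ι : Type*} [DecidableEq ι]

theorem flipAt_of_ne {σ : ι → Bool} {j l : ι} (h : l ≠ j) : flipAt σ j l = σ l := by
  simp [flipAt, h]

variable [Fintype ι] {K : ℝ}

theorem abs_sum_mul_spin_sub_flipAt_le (c : ι → ℝ) (S : Finset ι) (σ : ι → Bool) (j : ι) :
    |∑ k ∈ S, c k * spin (σ k) - ∑ k ∈ S, c k * spin (flipAt σ j k)| ≤ 2 * |c j| := by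
  rw [← sum_sub_distrib]
  calc |∑ k ∈ S, (c k * spin (σ k) - c k * spin (flipAt σ j k))|
      ≤ ∑ k ∈ S, |c k * spin (σ k) - c k * spin (flipAt σ j k)| := abs_sum_le_sum_abs _ _
    _ ≤ ∑ k, |c k * spin (σ k) - c k * spin (flipAt σ j k)| :=
        sum_le_sum_of_subset_of_nonneg (subset_univ S) fun _ _ _ => abs_nonneg _
    _ = |c j * spin (σ j) - c j * spin (flipAt σ j j)| :=
        sum_eq_single_of_mem j (mem_univ j) fun k _ hk => by simp [flipAt_of_ne hk]
    _ ≤ |c j * spin (σ j)| + |c j * spin (flipAt σ j j)| := abs_sub _ _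
    _ = 2 * |c j| := by simp only [abs_mul, abs_spin]; ring

theorem psi_eq_logRatio (J : ι → ι → ℝ) (δ : ℝ) (i : ι) (σ : ι → Bool) :
    psi J δ i σ = (1 / 2) * (logRatio δ (2 * hfun J i σ) 0 +
      ∑ l ∈ univ.erase i,
        logRatio δ (2 * (J i l * spin (σ l))) (-(2 * (spin (σ l) * hil J i l σ)))) := by
  unfold psi logRatio
  congr 2
  · ring_nf
  · refine sum_congr rfl fun l _ => ?_
    ring_nf

theorem abs_psi_sub_flipAt_le {J : ι → ι → ℝ} {δ : ℝ} {i : ι} (hδ : 0 ≤ δ)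
    (hK : ∑ k, |J i k| ≤ K) (σ : ι → Bool) (j : ι) :
    |psi J δ i σ - psi J δ i (flipAt σ j)| ≤
      8 * Real.exp (2 * K) ^ 2 * (1 + K) * δ * |J i j| := by
  set E := Real.exp (2 * K)
  have hK0 : 0 ≤ K := (sum_nonneg fun k _ => abs_nonneg (J i k)).trans hK
  have hE : 1 ≤ E := Real.one_le_exp (by linarith)
  have hh : ∀ τ, |2 * hfun J i τ| ≤ 2 * K := fun τ => by
    rw [hfun, abs_mul, abs_two, abs_neg]
    linarith [abs_sum_mul_spin_le hK univ τ]
  have hx : ∀ l τ, |-(2 * (spin (τ l) * hil J i l τ))| ≤ 2 * K := fun l τ => by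
    rw [hil, abs_neg, abs_mul, abs_two, abs_mul, abs_spin, abs_neg, one_mul]
    linarith [abs_sum_mul_spin_le hK (univ.erase l) τ]
  have ha_eq : ∀ l (τ : ι → Bool), |2 * (J i l * spin (τ l))| = 2 * |J i l| := fun l τ => by
    rw [abs_mul, abs_two, abs_mul, abs_spin, mul_one]
  have ha : ∀ l (τ : ι → Bool), |2 * (J i l * spin (τ l))| ≤ 2 * K := fun l τ => by
    rw [ha_eq]
    linarith [single_le_sum (fun k _ => abs_nonneg (J i k)) (mem_univ l)]
  have hfirst : |logRatio δ (2 * hfun J i σ) 0 - logRatio δ (2 * hfun J i (flipAt σ j)) 0| ≤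
      8 * δ * E ^ 2 * |J i j| := by
    have hdiff : |2 * hfun J i σ - 2 * hfun J i (flipAt σ j)| ≤ 4 * |J i j| := by
      rw [← mul_sub, abs_mul, abs_two, hfun, hfun, neg_sub_neg, abs_sub_comm]
      linarith [abs_sum_mul_spin_sub_flipAt_le (J i) univ σ j]
    calc _ ≤ 2 * δ * E * |2 * hfun J i σ - 2 * hfun J i (flipAt σ j)| :=
          abs_logRatio_zero_sub_le hδ (hh _) (hh _)
      _ ≤ 2 * δ * E ^ 2 * (4 * |J i j|) := by
          gcongr
          exact le_self_pow₀ hE two_ne_zero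
      _ = _ := by ring
  have hterm : ∀ l, |logRatio δ (2 * (J i l * spin (σ l))) (-(2 * (spin (σ l) * hil J i l σ))) -
      logRatio δ (2 * (J i l * spin (flipAt σ j l)))
        (-(2 * (spin (flipAt σ j l) * hil J i l (flipAt σ j))))| ≤
      16 * δ * E ^ 2 * |J i j| * |J i l| + if l = j then 8 * δ * E ^ 2 * |J i j| else 0 := by
    intro l
    by_cases hl : l = j
    · subst hl
      rw [if_pos rfl]
      have h1 := abs_logRatio_le hδ (ha l σ) (hx l σ)
      have h2 := abs_logRatio_le hδ (ha l (flipAt σ l)) (hx l (flipAt σ l))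
      rw [ha_eq] at h1 h2
      have h3 : 0 ≤ 16 * δ * E ^ 2 * |J i l| * |J i l| := by positivity
      refine (abs_sub _ _).trans ?_
      linarith
    · rw [if_neg hl, add_zero]
      have hb := hx l (flipAt σ j)
      rw [flipAt_of_ne hl] at hb ⊢
      have hdiff : |-(2 * (spin (σ l) * hil J i l σ)) -
          -(2 * (spin (σ l) * hil J i l (flipAt σ j)))| ≤ 4 * |J i j| := by
        rw [neg_sub_neg, ← mul_sub, ← mul_sub, abs_mul, abs_two, abs_mul, abs_spin, one_mul,
          hil, hil, neg_sub_neg]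
        linarith [abs_sum_mul_spin_sub_flipAt_le (J i) (univ.erase l) σ j]
      refine (abs_logRatio_sub_le hδ (ha l σ) (hx l σ) hb).trans ?_
      rw [ha_eq]
      calc _ ≤ 2 * δ * E ^ 2 * (2 * |J i l|) * (4 * |J i j|) := by gcongr
        _ = _ := by ring
  rw [psi_eq_logRatio, psi_eq_logRatio, ← mul_sub, add_sub_add_comm, ← sum_sub_distrib, abs_mul,
    abs_of_pos (one_half_pos (α := ℝ))]
  have hsum := (abs_sum_le_sum_abs _ _).trans
    ((sum_le_sum fun l _ => hterm l).trans
      (sum_le_sum_of_subset_of_nonneg (erase_subset i univ) fun l _ _ =>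
        (abs_nonneg _).trans (hterm l)))
  rw [sum_add_distrib, ← mul_sum, sum_ite_eq' univ j, if_pos (mem_univ j)] at hsum
  have hmul : 16 * δ * E ^ 2 * |J i j| * ∑ l, |J i l| ≤ 16 * δ * E ^ 2 * |J i j| * K := by
    gcongr
  have := abs_add_le (logRatio δ (2 * hfun J i σ) 0 - logRatio δ (2 * hfun J i (flipAt σ j)) 0)
    (∑ l ∈ univ.erase i,
      (logRatio δ (2 * (J i l * spin (σ l))) (-(2 * (spin (σ l) * hil J i l σ))) -
      logRatio δ (2 * (J i l * spin (flipAt σ j l)))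
        (-(2 * (spin (flipAt σ j l) * hil J i l (flipAt σ j))))))
  linarith

theorem sum_rho_psi_le {J : ι → ι → ℝ} {δ : ℝ} {i : ι} (hδ : 0 ≤ δ) (hK : ∑ k, |J i k| ≤ K) :
    ∑ j, rho j (psi J δ i) ≤ 8 * Real.exp (2 * K) ^ 2 * (1 + K) * K * δ := by
  have hK0 : 0 ≤ K := (sum_nonneg fun k _ => abs_nonneg (J i k)).trans hK
  calc ∑ j, rho j (psi J δ i)
      ≤ ∑ j, 8 * Real.exp (2 * K) ^ 2 * (1 + K) * δ * |J i j| :=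
        sum_le_sum fun j _ => sup'_le _ _ fun σ _ => abs_psi_sub_flipAt_le hδ hK σ j
    _ = 8 * Real.exp (2 * K) ^ 2 * (1 + K) * δ * ∑ j, |J i j| := (mul_sum _ _ _).symm
    _ ≤ 8 * Real.exp (2 * K) ^ 2 * (1 + K) * δ * K := by gcongr
    _ = _ := by ring

end Flip

/-- There exist `δ* > 0` and `C < ∞` depending only on `J̄` such that for every
finite volume `V` and every `δ ∈ [0,δ*]`, `sup_{i∈V} Σ_{j∈V} ρ_j(ψ_{i,δ}) ≤ C δ`. -/
theorem rho_psi_bound (Jbar : ℝ) :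
    ∃ δstar > (0 : ℝ), ∃ C : ℝ, ∀ (d : ℕ) (J : (Fin d → ℤ) → (Fin d → ℤ) → ℝ),
      (∀ i j, J i j = J j i) → (∀ i, J i i = 0) →
      (∀ i, Summable fun j => |J i j|) → (∀ i, ∑' j, |J i j| ≤ Jbar) →
      ∀ V : Finset (Fin d → ℤ), ∀ δ ∈ Set.Icc (0 : ℝ) δstar, ∀ i : ↥V,
        ∑ j : ↥V, rho j (psi (Jres J V) δ i) ≤ C * δ := by
  refine ⟨1, one_pos, 8 * Real.exp (2 * Jbar) ^ 2 * (1 + Jbar) * Jbar, ?_⟩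
  intro d J _ _ hsummable hbound V δ hδ i
  refine sum_rho_psi_le hδ.1 ?_
  calc ∑ k : ↥V, |J i k| = ∑ k ∈ V, |J i k| := sum_coe_sort V fun k => |J i k|
    _ ≤ ∑' k, |J i k| := (hsummable i).sum_le_tsum V fun k _ => abs_nonneg _
    _ ≤ Jbar := hbound i
end

section
/- Assume sup_{i∈ℤ^d} Σ_{j∈ℤ^d} tanh(2|J_{ij}|) < 1. Then there exist δ₀ > 0 and γ' < 1 such that for every finite V ⊂ ℤ^d and every δ ∈ [0,δ₀], the Dobrushin coefficients γ_{ij} of π^{PCA} on V with parameter δ satisfy sup_{i∈V} Σ_{j∈V, j≠i} γ_{ij} ≤ γ' < 1, i.e. π^{PCA} satisfies the Dobrushin uniqueness condition uniformly in V and δ. -/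
open Finset

namespace PCA

/-- The perturbation `u ↦ log (1 + t e^u)` of the log-density. -/
noncomputable def logPert (t u : ℝ) : ℝ := Real.log (1 + t * Real.exp u)

section logPert

variable {t : ℝ}

theorem one_add_mul_exp_pos (ht : 0 ≤ t) (u : ℝ) : 0 < 1 + t * Real.exp u := by positivity

theorem hasDerivAt_logPert (ht : 0 ≤ t) (u : ℝ) :
    HasDerivAt (logPert t) (t * Real.exp u / (1 + t * Real.exp u)) u :=
  (((Real.hasDerivAt_exp u).const_mul t).const_add 1).log (one_add_mul_exp_pos ht u).ne'

theorem hasDerivAt_deriv_logPert (ht : 0 ≤ t) (u : ℝ) :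
    HasDerivAt (fun v => t * Real.exp v / (1 + t * Real.exp v))
      (t * Real.exp u / (1 + t * Real.exp u) ^ 2) u := by
  have h := (Real.hasDerivAt_exp u).const_mul t
  refine (h.div (h.const_add 1) (one_add_mul_exp_pos ht u).ne').congr_deriv ?_
  congr 1
  ring

theorem mul_exp_div_pow_le (ht : 0 ≤ t) {u A : ℝ} (hu : u ≤ A) (n : ℕ) :
    ‖t * Real.exp u / (1 + t * Real.exp u) ^ n‖ ≤ t * Real.exp A := by
  have h0 : 0 ≤ t * Real.exp u := by positivity
  rw [Real.norm_of_nonneg (by positivity)]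
  calc t * Real.exp u / (1 + t * Real.exp u) ^ n ≤ t * Real.exp u :=
        div_le_self h0 (one_le_pow₀ (by linarith))
    _ ≤ t * Real.exp A := by gcongr

theorem abs_logPert_sub_le (ht : 0 ≤ t) {A u v : ℝ} (hu : u ≤ A) (hv : v ≤ A) :
    |logPert t u - logPert t v| ≤ t * Real.exp A * |u - v| :=
  (convex_Iic A).norm_image_sub_le_of_norm_hasDerivWithin_le
    (fun x _ => (hasDerivAt_logPert ht x).hasDerivWithinAt)
    (fun x hx => by simpa using mul_exp_div_pow_le ht hx 1) hv hu

theorem abs_deriv_logPert_sub_le (ht : 0 ≤ t) {A u v : ℝ} (hu : u ≤ A) (hv : v ≤ A) :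
    |t * Real.exp u / (1 + t * Real.exp u) - t * Real.exp v / (1 + t * Real.exp v)| ≤
      t * Real.exp A * |u - v| :=
  (convex_Iic A).norm_image_sub_le_of_norm_hasDerivWithin_le
    (fun x _ => (hasDerivAt_deriv_logPert ht x).hasDerivWithinAt)
    (fun _ hx => mul_exp_div_pow_le ht hx 2) hv hu

theorem abs_logPert_mixed_diff_le (ht : 0 ≤ t) {A x r s : ℝ} (h0 : x ≤ A) (hr : x + r ≤ A)
    (hs : x + s ≤ A) (hsr : x + s + r ≤ A) :
    |(logPert t (x + s + r) - logPert t (x + s)) - (logPert t (x + r) - logPert t x)| ≤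
      t * Real.exp A * |r| * |s| := by
  have key := (convex_Iic (min A (A - r))).norm_image_sub_le_of_norm_hasDerivWithin_le
    (f := fun y => logPert t (y + r) - logPert t y) (C := t * Real.exp A * |r|)
    (x := x) (y := x + s)
    (fun y _ => (((hasDerivAt_logPert ht (y + r)).comp_add_const y r).sub
      (hasDerivAt_logPert ht y)).hasDerivWithinAt)
    (fun y hy => by
      have hy' : y ≤ A ∧ y ≤ A - r := le_min_iff.mp hy
      simpa using abs_deriv_logPert_sub_le ht (u := y + r) (v := y) (by linarith) hy'.1)
    (le_min h0 (by linarith)) (le_min hs (by linarith))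
  simpa using key

end logPert

section sigmoid

theorem exp_div_exp_add_exp (p q : ℝ) :
    Real.exp p / (Real.exp p + Real.exp q) = 1 / (1 + Real.exp (q - p)) := by
  rw [Real.exp_sub]
  field_simp

theorem exp_div_exp_add_exp_sub_le {a b a' b' s : ℝ} (h : (a - b) - (a' - b') = 4 * s)
    (hs : 0 ≤ s) :
    Real.exp a / (Real.exp a + Real.exp b) - Real.exp a' / (Real.exp a' + Real.exp b') ≤
      Real.tanh s := by
  set m := ((b - a) + (b' - a')) / 2 with hm
  have e2 : b - a = m - 2 * s := by rw [hm]; linarith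
  have e3 : b' - a' = m + 2 * s := by rw [hm]; linarith
  rw [exp_div_exp_add_exp, exp_div_exp_add_exp, e2, e3, Real.tanh_eq_sinh_div_cosh,
    Real.sinh_eq, Real.cosh_eq, Real.exp_sub, Real.exp_add, Real.exp_neg, two_mul, Real.exp_add]
  have hp : 0 < Real.exp m := Real.exp_pos m
  have hq : 1 ≤ Real.exp s := Real.one_le_exp hs
  generalize Real.exp m = p at *
  generalize Real.exp s = q at *
  have hq0 : 0 < q := by linarith
  have l1 : 1 / (1 + p / (q * q)) - 1 / (1 + p * (q * q)) =
      p * (q ^ 4 - 1) / ((q ^ 2 + p) * (1 + p * q ^ 2)) := by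
    field_simp
    ring
  have l2 : (q - q⁻¹) / 2 / ((q + q⁻¹) / 2) = (q ^ 2 - 1) / (q ^ 2 + 1) := by
    field_simp
  rw [l1, l2, div_le_div_iff₀ (by positivity) (by positivity)]
  have hq2 : 0 ≤ q ^ 2 - 1 := by nlinarith
  have : 0 ≤ (q ^ 2 - 1) * (q ^ 2 * (p - 1) ^ 2) := by positivity
  nlinarith [this]

theorem abs_exp_div_exp_add_exp_sub_le (a b a' b' : ℝ) :
    |Real.exp a / (Real.exp a + Real.exp b) - Real.exp a' / (Real.exp a' + Real.exp b')| ≤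
      Real.tanh (|(a - b) - (a' - b')| / 4) := by
  wlog h : a' - b' ≤ a - b generalizing a b a' b'
  · rw [abs_sub_comm, abs_sub_comm (a - b)]
    exact this a' b' a b (by linarith)
  have hmono : Real.exp a' / (Real.exp a' + Real.exp b') ≤
      Real.exp a / (Real.exp a + Real.exp b) := by
    rw [exp_div_exp_add_exp, exp_div_exp_add_exp]
    have := Real.exp_le_exp.mpr (show b - a ≤ b' - a' by linarith)
    gcongr
  rw [abs_of_nonneg (sub_nonneg.mpr hmono), abs_of_nonneg (by linarith : 0 ≤ a - b - (a' - b'))]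
  exact exp_div_exp_add_exp_sub_le (by ring) (by linarith)

theorem tanh_nonneg {x : ℝ} (hx : 0 ≤ x) : 0 ≤ Real.tanh x := by
  rw [Real.tanh_eq_sinh_div_cosh]
  exact div_nonneg (Real.sinh_nonneg_iff.mpr hx) (Real.cosh_pos x).le

theorem hasDerivAt_tanh (x : ℝ) : HasDerivAt Real.tanh (1 / Real.cosh x ^ 2) x := by
  have h := (Real.hasDerivAt_sinh x).div (Real.hasDerivAt_cosh x) (Real.cosh_pos x).ne'
  have e : Real.tanh = Real.sinh / Real.cosh := funext Real.tanh_eq_sinh_div_cosh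
  rw [e]
  refine h.congr_deriv ?_
  rw [← sq, ← sq, Real.cosh_sq_sub_sinh_sq]

theorem monotone_tanh : Monotone Real.tanh :=
  monotone_of_hasDerivAt_nonneg hasDerivAt_tanh fun x => by
    have := Real.cosh_pos x
    simp only [Pi.zero_apply]
    positivity

theorem monotone_sub_tanh : Monotone fun x => x - Real.tanh x :=
  monotone_of_hasDerivAt_nonneg (fun x => (hasDerivAt_id x).sub (hasDerivAt_tanh x)) fun x => by
    simp only [Pi.zero_apply, sub_nonneg]
    exact div_le_one_of_le₀ (one_le_pow₀ (Real.one_le_cosh x)) (by positivity)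

theorem tanh_le_tanh_add {x a b : ℝ} (hx : x ≤ a + b) (hb : 0 ≤ b) :
    Real.tanh x ≤ Real.tanh a + b := by
  have h1 := monotone_tanh hx
  have h2 := monotone_sub_tanh (show a ≤ a + b by linarith)
  simp only at h2
  linarith

end sigmoid

section measure

variable {ι : Type*} [Fintype ι]

/-- The exponent of `phi`. -/
noncomputable def phiExponent (J : ι → ι → ℝ) (k : ι) (σ : ι → Bool) : ℝ :=
  -2 * (spin (σ k) * ∑ l, J k l * spin (σ l))

/-- The contribution of the site `k` to the logarithm of the density of `piPCA`. -/
noncomputable def siteWeight (J : ι → ι → ℝ) (t : ℝ) (k : ι) (σ : ι → Bool) : ℝ :=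
  -phiExponent J k σ / 2 + logPert t (phiExponent J k σ)

/-- The logarithm of the unnormalised density of `piPCA`. -/
noncomputable def logDensity (J : ι → ι → ℝ) (t : ℝ) (σ : ι → Bool) : ℝ :=
  ∑ k, siteWeight J t k σ

theorem phi_eq_exp_phiExponent (J : ι → ι → ℝ) (k : ι) (σ : ι → Bool) :
    phi J k σ = Real.exp (phiExponent J k σ) := by
  rw [phi, phiExponent, Finset.mul_sum (a := spin (σ k))]
  congr 2
  exact Finset.sum_congr rfl fun _ _ => by ring

theorem neg_Ham_eq (J : ι → ι → ℝ) (σ : ι → Bool) :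
    -Ham J σ = ∑ k, -phiExponent J k σ / 2 := by
  rw [Ham, neg_neg]
  refine Finset.sum_congr rfl fun k _ => ?_
  rw [phiExponent, Finset.mul_sum]
  rw [show ∀ x : ℝ, -(-2 * x) / 2 = x by intro x; ring]
  exact Finset.sum_congr rfl fun _ _ => by ring

theorem exp_logDensity (J : ι → ι → ℝ) {t : ℝ} (ht : 0 ≤ t) (σ : ι → Bool) :
    Real.exp (logDensity J t σ) = Real.exp (-Ham J σ) * fδ J t σ := by
  simp only [logDensity, siteWeight]
  rw [Finset.sum_add_distrib, Real.exp_add, ← neg_Ham_eq, Real.exp_sum, fδ]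
  congr 1
  refine Finset.prod_congr rfl fun k _ => ?_
  rw [logPert, Real.exp_log (one_add_mul_exp_pos ht _), phi_eq_exp_phiExponent]

theorem abs_spin (b : Bool) : |spin b| = 1 := by cases b <;> simp [spin]

theorem abs_spin_sub_le (b c : Bool) : |spin b - spin c| ≤ 2 := by
  have := abs_sub (spin b) (spin c)
  rw [abs_spin, abs_spin] at this
  linarith

theorem abs_phiExponent_le {J : ι → ι → ℝ} {B : ℝ} (hB : ∀ k, ∑ l, |J k l| ≤ B) (k : ι)
    (σ : ι → Bool) : |phiExponent J k σ| ≤ 2 * B := by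
  rw [phiExponent, abs_mul, abs_mul, abs_spin, one_mul, abs_neg, abs_two]
  gcongr
  refine (Finset.abs_sum_le_sum_abs _ _).trans (le_trans (Finset.sum_le_sum fun l _ => ?_) (hB k))
  rw [abs_mul, abs_spin, mul_one]

variable [DecidableEq ι]

theorem exists_piPCA_eq (J : ι → ι → ℝ) {t : ℝ} (ht : 0 ≤ t) :
    ∃ C > 0, ∀ σ, piPCA J t σ = C * Real.exp (logDensity J t σ) := by
  have hZ : 0 < ∑ τ : ι → Bool, Real.exp (-Ham J τ) :=
    Finset.sum_pos (fun _ _ => Real.exp_pos _) Finset.univ_nonempty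
  have hf : ∀ σ, 0 < fδ J t σ := fun σ => Finset.prod_pos fun k _ => by
    rw [phi_eq_exp_phiExponent]
    exact one_add_mul_exp_pos ht _
  have hE : 0 < Emean (piG J) (fδ J t) :=
    Finset.sum_pos (fun σ _ => mul_pos (div_pos (Real.exp_pos _) hZ) (hf σ))
      Finset.univ_nonempty
  refine ⟨1 / ((∑ τ : ι → Bool, Real.exp (-Ham J τ)) * Emean (piG J) (fδ J t)),
    by positivity, fun σ => ?_⟩
  rw [exp_logDensity J ht, piPCA, piG]
  field_simp

theorem condProb_piPCA (J : ι → ι → ℝ) {t : ℝ} (ht : 0 ≤ t) (i : ι) (σ : ι → Bool) :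
    condProb (piPCA J t) i σ =
      Real.exp (logDensity J t (Function.update σ i true)) /
        (Real.exp (logDensity J t (Function.update σ i true)) +
          Real.exp (logDensity J t (Function.update σ i false))) := by
  obtain ⟨C, hC, h⟩ := exists_piPCA_eq J ht
  rw [condProb, h, h, ← mul_add, mul_div_mul_left _ _ hC.ne']

theorem exists_sum_update_eq (a : ι → ℝ) (σ : ι → Bool) {i j : ι} (hij : i ≠ j) :
    ∃ R, ∀ x y, ∑ l, a l * spin (Function.update (Function.update σ j y) i x l) =
      R + a i * spin x + a j * spin y := by
  refine ⟨∑ l ∈ (Finset.univ.erase i).erase j, a l * spin (σ l), fun x y => ?_⟩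
  rw [← Finset.add_sum_erase _ _ (Finset.mem_univ i),
    ← Finset.add_sum_erase _ _ (Finset.mem_erase.mpr ⟨hij.symm, Finset.mem_univ j⟩)]
  have : ∑ l ∈ (Finset.univ.erase i).erase j,
      a l * spin (Function.update (Function.update σ j y) i x l) =
      ∑ l ∈ (Finset.univ.erase i).erase j, a l * spin (σ l) :=
    Finset.sum_congr rfl fun l hl => by
      simp only [Finset.mem_erase] at hl
      rw [Function.update_of_ne hl.2.1, Function.update_of_ne hl.1]
  rw [this]
  simp [Function.update_of_ne hij.symm]
  ring

/-- The mixed second difference of `g` in the values of two spins. -/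
def mixedDiff (g : Bool → Bool → ℝ) (y y' : Bool) : ℝ :=
  (g true y - g false y) - (g true y' - g false y')

/-- Bound for the mixed difference of a function of a product of spins with an affine function. -/
theorem abs_diff_spin_mul_affine_le {Φ : ℝ → ℝ} {A L : ℝ} (hL : 0 ≤ L)
    (hΦ : ∀ u v, |u| ≤ A → |v| ≤ A → |Φ u - Φ v| ≤ L * |u - v|) {R a : ℝ} {x y y' : Bool}
    (h : |-2 * (spin x * (R + a * spin y))| ≤ A) (h' : |-2 * (spin x * (R + a * spin y'))| ≤ A) :
    |Φ (-2 * (spin x * (R + a * spin y))) - Φ (-2 * (spin x * (R + a * spin y')))| ≤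
      4 * L * |a| := by
  refine (hΦ _ _ h h').trans ?_
  rw [show -2 * (spin x * (R + a * spin y)) - -2 * (spin x * (R + a * spin y')) =
    -2 * spin x * a * (spin y - spin y') by ring, abs_mul, abs_mul, abs_mul, abs_spin, abs_neg,
    abs_two]
  have := mul_le_mul_of_nonneg_left (abs_spin_sub_le y y') (mul_nonneg hL (abs_nonneg a))
  linarith

theorem abs_mixedDiff_site_le {J : ι → ι → ℝ} (hsym : ∀ i j, J i j = J j i)
    (hdiag : ∀ i, J i i = 0) {B t : ℝ} (ht : 0 ≤ t) (hB : ∀ k, ∑ l, |J k l| ≤ B)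
    (σ : ι → Bool) {i j : ι} (hij : i ≠ j) (k : ι) (y y' : Bool) :
    |mixedDiff (fun x z => siteWeight J t k (Function.update (Function.update σ j z) i x)) y y'| ≤
      16 * (t * Real.exp (2 * B)) * (|J k i| * |J k j|) +
        ((if k = i then (4 + 8 * (t * Real.exp (2 * B))) * |J i j| else 0) +
          (if k = j then (4 + 8 * (t * Real.exp (2 * B))) * |J i j| else 0)) := by
  obtain ⟨R, hR⟩ := exists_sum_update_eq (J k) σ hij
  have hu : ∀ x z, |phiExponent J k (Function.update (Function.update σ j z) i x)| ≤ 2 * B :=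
    fun x z => abs_phiExponent_le hB k _
  have hL : 0 ≤ t * Real.exp (2 * B) := by positivity
  generalize hK : t * Real.exp (2 * B) = K at *
  have hΦ : ∀ u v, |u| ≤ 2 * B → |v| ≤ 2 * B →
      |(-u / 2 + logPert t u) - (-v / 2 + logPert t v)| ≤ (1 / 2 + K) * |u - v| := by
    intro u v h h'
    have h1 := abs_logPert_sub_le ht (le_of_abs_le h) (le_of_abs_le h')
    rw [hK] at h1
    have h2 : |(-u / 2 + logPert t u) - (-v / 2 + logPert t v)| ≤
        |-(1 / 2) * (u - v)| + |logPert t u - logPert t v| := by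
      refine le_trans (le_of_eq ?_) (abs_add_le _ _)
      congr 1
      ring
    rw [abs_mul, abs_neg, abs_of_pos (by norm_num : (0 : ℝ) < 1 / 2)] at h2
    linarith
  simp only [siteWeight, phiExponent, hR] at hu ⊢
  by_cases hki : k = i
  · subst hki
    simp only [Function.update_self, hdiag, zero_mul, add_zero] at hu ⊢
    have h1 := abs_diff_spin_mul_affine_le (by positivity) hΦ (hu true y) (hu true y')
    have h2 := abs_diff_spin_mul_affine_le (by positivity) hΦ (hu false y) (hu false y')
    simp only [mixedDiff, if_true, if_neg hij, abs_zero, zero_mul, mul_zero, zero_add, add_zero]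
    rw [sub_sub_sub_comm]
    refine (abs_sub _ _).trans ((add_le_add h1 h2).trans (le_of_eq ?_))
    ring
  by_cases hkj : k = j
  · subst hkj
    simp only [Function.update_of_ne hij.symm, Function.update_self, hdiag, zero_mul,
      add_zero] at hu ⊢
    have h1 := abs_diff_spin_mul_affine_le (by positivity) hΦ (hu true y) (hu false y)
    have h2 := abs_diff_spin_mul_affine_le (by positivity) hΦ (hu true y') (hu false y')
    simp only [mixedDiff, if_true, if_neg hki, abs_zero, mul_zero, zero_add]
    refine (abs_sub _ _).trans ((add_le_add h1 h2).trans (le_of_eq ?_))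
    rw [hsym k i]
    ring
  simp only [Function.update_of_ne hki, Function.update_of_ne hkj, if_neg hki, if_neg hkj,
    add_zero] at hu ⊢
  have hle := fun x z => le_of_abs_le (hu x z)
  have hle := fun x z => le_of_abs_le (hu x z)
  have hs1 : |spin (σ k)| = 1 := abs_spin _
  generalize spin (σ k) = s at *
  obtain ⟨u, hudef⟩ : ∃ u : Bool → Bool → ℝ,
      ∀ x z, u x z = -2 * (s * (R + J k i * spin x + J k j * spin z)) := ⟨_, fun _ _ => rfl⟩
  simp only [← hudef] at hle ⊢
  set r := -4 * s * J k i with hr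
  set w := -2 * s * J k j * (spin y - spin y') with hw
  have e1 : u true y' = u false y' + r := by simp only [hudef, spin, if_true, hr]; simp; ring
  have e2 : u false y = u false y' + w := by simp only [hudef, hw]; ring
  have e3 : u true y = u false y' + w + r := by rw [← e2]; simp [hudef, spin, hr]; ring
  have key := abs_logPert_mixed_diff_le ht (hle false y') (e1 ▸ hle true y') (e2 ▸ hle false y)
    (e3 ▸ hle true y)
  rw [hK] at key
  have hlin : mixedDiff (fun x z => -u x z / 2 + logPert t (u x z)) y y' =
      (logPert t (u false y' + w + r) - logPert t (u false y' + w)) -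
        (logPert t (u false y' + r) - logPert t (u false y')) := by
    simp only [mixedDiff, e1, e2, e3]
    ring
  rw [hlin]
  refine key.trans ?_
  rw [hr, hw]
  simp only [abs_mul, abs_neg, hs1, Nat.abs_ofNat]
  have := mul_le_mul_of_nonneg_left (abs_spin_sub_le y y')
    (mul_nonneg (mul_nonneg hL (abs_nonneg (J k i))) (abs_nonneg (J k j)))
  linarith

theorem abs_mixedDiff_logDensity_le {J : ι → ι → ℝ} (hsym : ∀ i j, J i j = J j i)
    (hdiag : ∀ i, J i i = 0) {B t : ℝ} (ht : 0 ≤ t) (hB : ∀ k, ∑ l, |J k l| ≤ B)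
    (σ : ι → Bool) {i j : ι} (hij : i ≠ j) (y y' : Bool) :
    |mixedDiff (fun x z => logDensity J t (Function.update (Function.update σ j z) i x)) y y'| ≤
      8 * |J i j| + 16 * (t * Real.exp (2 * B)) * ((∑ k, |J k i| * |J k j|) + |J i j|) := by
  have h : mixedDiff (fun x z => logDensity J t (Function.update (Function.update σ j z) i x)) y y' =
      ∑ k, mixedDiff
        (fun x z => siteWeight J t k (Function.update (Function.update σ j z) i x)) y y' := by
    simp only [mixedDiff, logDensity, Finset.sum_sub_distrib]
  rw [h]
  refine (Finset.abs_sum_le_sum_abs _ _).trans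
    ((Finset.sum_le_sum fun k _ => abs_mixedDiff_site_le hsym hdiag ht hB σ hij k y y').trans
      (le_of_eq ?_))
  rw [Finset.sum_add_distrib, Finset.sum_add_distrib, Finset.sum_ite_eq', Finset.sum_ite_eq',
    ← Finset.mul_sum]
  simp only [Finset.mem_univ, if_true]
  ring

theorem dobr_piPCA_le {J : ι → ι → ℝ} (hsym : ∀ i j, J i j = J j i)
    (hdiag : ∀ i, J i i = 0) {B t : ℝ} (ht : 0 ≤ t) (hB : ∀ k, ∑ l, |J k l| ≤ B)
    {i j : ι} (hij : i ≠ j) :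
    dobr (piPCA J t) i j ≤ Real.tanh (2 * |J i j|) +
      4 * (t * Real.exp (2 * B)) * ((∑ k, |J k i| * |J k j|) + |J i j|) := by
  refine Finset.sup'_le _ _ fun σ _ => ?_
  rw [condProb_piPCA J ht, condProb_piPCA J ht, flipAt]
  refine (abs_exp_div_exp_add_exp_sub_le _ _ _ _).trans ?_
  have h := abs_mixedDiff_logDensity_le hsym hdiag ht hB σ hij (σ j) (!σ j)
  simp only [mixedDiff, Function.update_eq_self] at h
  exact tanh_le_tanh_add (by linarith) (by positivity)

theorem sum_dobr_piPCA_le {J : ι → ι → ℝ} (hsym : ∀ i j, J i j = J j i)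
    (hdiag : ∀ i, J i i = 0) {B t : ℝ} (ht : 0 ≤ t) (hB : ∀ k, ∑ l, |J k l| ≤ B) (i : ι) :
    ∑ j ∈ Finset.univ.erase i, dobr (piPCA J t) i j ≤
      ∑ j, Real.tanh (2 * |J i j|) + 4 * (t * Real.exp (2 * B)) * (B * B + B) := by
  have hB0 : 0 ≤ B := (Finset.sum_nonneg fun l _ => abs_nonneg (J i l)).trans (hB i)
  have hJJ : ∑ j, ∑ k, |J k i| * |J k j| ≤ B * B := by
    rw [Finset.sum_comm]
    simp only [← Finset.mul_sum, hsym _ i]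
    calc ∑ k, |J i k| * ∑ j, |J k j| ≤ ∑ k, |J i k| * B := by
          gcongr with k _
          exact hB k
      _ ≤ B * B := by
          rw [← Finset.sum_mul]
          gcongr
          exact hB i
  calc ∑ j ∈ Finset.univ.erase i, dobr (piPCA J t) i j
      ≤ ∑ j ∈ Finset.univ.erase i, (Real.tanh (2 * |J i j|) +
          4 * (t * Real.exp (2 * B)) * ((∑ k, |J k i| * |J k j|) + |J i j|)) :=
        Finset.sum_le_sum fun j hj =>
          dobr_piPCA_le hsym hdiag ht hB (Finset.ne_of_mem_erase hj).symm
    _ ≤ ∑ j, (Real.tanh (2 * |J i j|) +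
          4 * (t * Real.exp (2 * B)) * ((∑ k, |J k i| * |J k j|) + |J i j|)) :=
        Finset.sum_le_sum_of_subset_of_nonneg (Finset.erase_subset _ _) fun j _ _ =>
          add_nonneg (tanh_nonneg (by positivity)) (by positivity)
    _ = ∑ j, Real.tanh (2 * |J i j|) + 4 * (t * Real.exp (2 * B)) *
          (∑ j, ∑ k, |J k i| * |J k j| + ∑ j, |J i j|) := by
        rw [Finset.sum_add_distrib, ← Finset.mul_sum, Finset.sum_add_distrib]
    _ ≤ _ := by
        gcongr
        exact hB i

end measure

end PCA

/-- Under `sup_i Σ_j tanh(2|J_{ij}|) < 1`, the PCA measure satisfies the Dobrushin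
uniqueness condition uniformly in the volume `V` and in `δ ∈ [0,δ₀]` for some `δ₀ > 0`. -/
theorem pca_dobrushin_uniqueness {d : ℕ}
    (J : (Fin d → ℤ) → (Fin d → ℤ) → ℝ)
    (hsym : ∀ i j, J i j = J j i)
    (hdiag : ∀ i, J i i = 0)
    (hsumm : ∀ i, Summable fun j => |J i j|)
    (Jbar : ℝ) (hJbar : ∀ i, ∑' j, |J i j| ≤ Jbar)
    (hsummt : ∀ i, Summable fun j => Real.tanh (2 * |J i j|))
    (hdob : ∃ γ < (1 : ℝ), ∀ i, ∑' j, Real.tanh (2 * |J i j|) ≤ γ) :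
    ∃ δ₀ > (0 : ℝ), ∃ γ' < (1 : ℝ), ∀ V : Finset (Fin d → ℤ), ∀ t ∈ Set.Icc (0 : ℝ) δ₀,
      ∀ i : ↥V, ∑ j ∈ Finset.univ.erase i, dobr (piPCA (Jres J V) t) i j ≤ γ' := by
  obtain ⟨γ, hγ, hdob⟩ := hdob
  have hJ0 : 0 ≤ Jbar := (tsum_nonneg fun _ => abs_nonneg _).trans (hJbar 0)
  set K := 4 * Real.exp (2 * Jbar) * (Jbar * Jbar + Jbar) with hK
  have hK0 : 0 ≤ K := by positivity
  refine ⟨(1 - γ) / (2 * (K + 1)), div_pos (by linarith) (by linarith), (1 + γ) / 2, by linarith,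
    fun V t ht i => ?_⟩
  have hB : ∀ k : ↥V, ∑ l, |Jres J V k l| ≤ Jbar := fun k => by
    simp only [Jres]
    rw [Finset.sum_coe_sort V fun l => |J k l|]
    exact ((hsumm k).sum_le_tsum V fun _ _ => abs_nonneg _).trans (hJbar k)
  have htanh : ∑ j, Real.tanh (2 * |Jres J V i j|) ≤ γ := by
    simp only [Jres]
    rw [Finset.sum_coe_sort V fun l => Real.tanh (2 * |J i l|)]
    exact ((hsummt i).sum_le_tsum V fun _ _ => PCA.tanh_nonneg (by positivity)).trans (hdob i)
  have key := PCA.sum_dobr_piPCA_le (J := Jres J V) (fun i j => hsym i j) (fun i => hdiag i)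
    ht.1 hB i
  have ht2 := (le_div_iff₀ (by linarith)).mp ht.2
  have e : 4 * (t * Real.exp (2 * Jbar)) * (Jbar * Jbar + Jbar) = t * K := by rw [hK]; ring
  rw [e] at key
  linarith [ht.1]
end

section
/- (Föllmer's covariance estimate, finite-volume form.) Let π be a strictly positive probability measure on {−1,1}^V whose Dobrushin coefficients γ_{ij} satisfy γ := max_{i∈V} Σ_{j≠i} γ_{ij} < 1. Let Γ be the V×V matrix with entries γ_{ij} (and zero diagonal), and D := Σ_{n=0}^{∞} Γ^n (this series converges). Then for all functions f, g : {−1,1}^V → ℝ, |Cov_π(f,g)| ≤ (1/4) Σ_{i,j∈V} D_{ij} ρ_i(f) ρ_j(g). -/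
open Finset

section Dobrushin

variable {ι : Type*} [DecidableEq ι]

lemma flipAt_flipAt (σ : ι → Bool) (j : ι) : flipAt (flipAt σ j) j = σ := by
  simp [flipAt]

lemma condProb_mem_Icc {π : (ι → Bool) → ℝ} (hpos : ∀ σ, 0 < π σ) (i : ι) (σ : ι → Bool) :
    condProb π i σ ∈ Set.Icc (0 : ℝ) 1 := by
  have h1 := hpos (Function.update σ i true)
  have h2 := hpos (Function.update σ i false)
  refine ⟨by unfold condProb; positivity, ?_⟩
  exact div_le_one_of_le₀ (by linarith) (by linarith)

variable [Fintype ι]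

lemma abs_sub_flipAt_le_rho (j : ι) (g : (ι → Bool) → ℝ) (σ : ι → Bool) :
    |g σ - g (flipAt σ j)| ≤ rho j g :=
  Finset.le_sup' (fun σ => |g σ - g (flipAt σ j)|) (Finset.mem_univ σ)

lemma rho_le {j : ι} {g : (ι → Bool) → ℝ} {c : ℝ} (h : ∀ σ, |g σ - g (flipAt σ j)| ≤ c) :
    rho j g ≤ c :=
  Finset.sup'_le _ _ fun σ _ => h σ

lemma rho_nonneg (j : ι) (g : (ι → Bool) → ℝ) : 0 ≤ rho j g :=
  (abs_nonneg _).trans (abs_sub_flipAt_le_rho j g fun _ => true)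

lemma abs_condProb_sub_le_dobr (π : (ι → Bool) → ℝ) (i j : ι) (σ : ι → Bool) :
    |condProb π i σ - condProb π i (flipAt σ j)| ≤ dobr π i j :=
  Finset.le_sup' (fun σ => |condProb π i σ - condProb π i (flipAt σ j)|) (Finset.mem_univ σ)

lemma dobr_nonneg (π : (ι → Bool) → ℝ) (i j : ι) : 0 ≤ dobr π i j :=
  (abs_nonneg _).trans (abs_condProb_sub_le_dobr π i j fun _ => true)

lemma abs_update_sub_update_le_rho (i : ι) (f : (ι → Bool) → ℝ) (σ : ι → Bool) :
    |f (Function.update σ i true) - f (Function.update σ i false)| ≤ rho i f := by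
  simpa [flipAt] using abs_sub_flipAt_le_rho i f (Function.update σ i true)

lemma abs_sub_le_sum_rho (f : (ι → Bool) → ℝ) (σ τ : ι → Bool) :
    |f σ - f τ| ≤ ∑ i, rho i f := by
  suffices h : ∀ s : Finset ι, |f (s.piecewise σ τ) - f τ| ≤ ∑ i ∈ s, rho i f by
    simpa using h Finset.univ
  intro s
  induction s using Finset.induction_on with
  | empty => simp
  | insert a s ha ih =>
    rw [Finset.sum_insert ha, Finset.piecewise_insert]
    refine (abs_sub_le _ (f (s.piecewise σ τ)) _).trans (add_le_add ?_ ih)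
    set η := s.piecewise σ τ
    by_cases h : σ a = η a
    · rw [h, Function.update_eq_self, sub_self, abs_zero]
      exact rho_nonneg a f
    · have h' : σ a = !η a := by
        cases h1 : σ a <;> cases h2 : η a <;> simp_all
      rw [h', abs_sub_comm]
      exact abs_sub_flipAt_le_rho a f η

/-- The conditional expectation of `f` given the spins outside `i`. -/
noncomputable def condMean (π : (ι → Bool) → ℝ) (i : ι) (f : (ι → Bool) → ℝ)
    (σ : ι → Bool) : ℝ :=
  condProb π i σ * f (Function.update σ i true) +
    (1 - condProb π i σ) * f (Function.update σ i false)

lemma rho_condMean_self (π : (ι → Bool) → ℝ) (i : ι) (f : (ι → Bool) → ℝ) :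
    rho i (condMean π i f) ≤ 0 :=
  rho_le fun σ => by simp [condMean, condProb, flipAt]

lemma rho_condMean_le {π : (ι → Bool) → ℝ} (hpos : ∀ σ, 0 < π σ) {i j : ι} (hij : i ≠ j)
    (f : (ι → Bool) → ℝ) :
    rho j (condMean π i f) ≤ rho j f + dobr π i j * rho i f := by
  refine rho_le fun σ => ?_
  obtain ⟨hp0, hp1⟩ := condProb_mem_Icc hpos i σ
  have hcomm : ∀ b, Function.update (flipAt σ j) i b = flipAt (Function.update σ i b) j := by
    intro b
    simp only [flipAt, Function.update_of_ne hij.symm]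
    exact Function.update_comm hij.symm _ _ _
  have h1 := abs_sub_flipAt_le_rho j f (Function.update σ i true)
  have h2 := abs_sub_flipAt_le_rho j f (Function.update σ i false)
  have h3 := abs_update_sub_update_le_rho i f (flipAt σ j)
  have h4 := abs_condProb_sub_le_dobr π i j σ
  simp only [condMean]
  rw [hcomm, hcomm] at *
  set p := condProb π i σ
  set p' := condProb π i (flipAt σ j)
  set a := f (Function.update σ i true)
  set b := f (Function.update σ i false)
  set a' := f (flipAt (Function.update σ i true) j)
  set b' := f (flipAt (Function.update σ i false) j)
  calc |p * a + (1 - p) * b - (p' * a' + (1 - p') * b')|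
      = |p * (a - a') + (1 - p) * (b - b') + (p - p') * (a' - b')| := by congr 1; ring
    _ ≤ p * |a - a'| + (1 - p) * |b - b'| + |p - p'| * |a' - b'| := by
        refine (abs_add_three _ _ _).trans_eq ?_
        rw [abs_mul, abs_mul, abs_mul, abs_of_nonneg hp0, abs_of_nonneg (sub_nonneg.2 hp1)]
    _ ≤ p * rho j f + (1 - p) * rho j f + dobr π i j * rho i f := by
        have := sub_nonneg.2 hp1
        have := dobr_nonneg π i j
        gcongr
    _ = _ := by ring

lemma sum_comp_flipAt (i : ι) (F : (ι → Bool) → ℝ) : ∑ σ, F (flipAt σ i) = ∑ σ, F σ :=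
  Fintype.sum_bijective (fun σ => flipAt σ i)
    (Function.Involutive.bijective fun σ => flipAt_flipAt σ i) _ _ fun _ => rfl

lemma abs_Emean_sub_condMean_mul_le {π : (ι → Bool) → ℝ} (hpos : ∀ σ, 0 < π σ)
    (hprob : ∑ σ, π σ = 1) (i : ι) (f g : (ι → Bool) → ℝ) :
    |Emean π fun σ => (f σ - condMean π i f σ) * g σ| ≤ 1 / 4 * (rho i f * rho i g) := by
  set F : (ι → Bool) → ℝ := fun σ => π σ * ((f σ - condMean π i f σ) * g σ) with hF
  have hpair : ∀ σ, |F σ + F (flipAt σ i)| ≤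
      (π σ + π (flipAt σ i)) * (1 / 4 * (rho i f * rho i g)) := by
    intro σ
    have ha := hpos (Function.update σ i true)
    have hb := hpos (Function.update σ i false)
    have hf := abs_update_sub_update_le_rho i f σ
    have hg := abs_update_sub_update_le_rho i g σ
    have hsum : ∀ G : (ι → Bool) → ℝ, G σ + G (flipAt σ i) =
        G (Function.update σ i true) + G (Function.update σ i false) := by
      intro G
      cases h : σ i
      · have : Function.update σ i false = σ := by rw [← h, Function.update_eq_self]
        simp [flipAt, h, this, add_comm]
      · have : Function.update σ i true = σ := by rw [← h, Function.update_eq_self]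
        simp [flipAt, h, this]
    rw [hsum F, hsum π]
    simp only [hF, condMean, condProb, Function.update_idem]
    set a := π (Function.update σ i true)
    set b := π (Function.update σ i false)
    set u := f (Function.update σ i true)
    set v := f (Function.update σ i false)
    set x := g (Function.update σ i true)
    set y := g (Function.update σ i false)
    have hab : a * b / (a + b) ≤ (a + b) * (1 / 4) := by
      rw [div_le_iff₀ (by positivity)]
      nlinarith [sq_nonneg (a - b)]
    calc _ = |a * b / (a + b) * ((u - v) * (x - y))| := by
          congr 1
          field_simp
          ring
      _ = a * b / (a + b) * (|u - v| * |x - y|) := by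
          rw [abs_mul, abs_mul, abs_of_nonneg (by positivity)]
      _ ≤ (a + b) * (1 / 4) * (rho i f * rho i g) := by
          have := rho_nonneg i f
          gcongr
      _ = _ := by ring
  have hdouble : 2 * Emean π (fun σ => (f σ - condMean π i f σ) * g σ) =
      ∑ σ, (F σ + F (flipAt σ i)) := by
    rw [Finset.sum_add_distrib, sum_comp_flipAt, ← two_mul]
    rfl
  have hbound : |∑ σ, (F σ + F (flipAt σ i))| ≤ 2 * (1 / 4 * (rho i f * rho i g)) := by
    refine (Finset.abs_sum_le_sum_abs _ _).trans ((Finset.sum_le_sum fun σ _ => hpair σ).trans_eq ?_)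
    rw [← Finset.sum_mul, Finset.sum_add_distrib, sum_comp_flipAt, hprob]
    norm_num
  rw [← hdouble, abs_mul, abs_two] at hbound
  linarith

lemma Emean_condMean {π : (ι → Bool) → ℝ} (hpos : ∀ σ, 0 < π σ) (hprob : ∑ σ, π σ = 1)
    (i : ι) (f : (ι → Bool) → ℝ) : Emean π (fun σ => f σ - condMean π i f σ) = 0 := by
  have h := abs_Emean_sub_condMean_mul_le hpos hprob i f fun _ => 1
  have h1 : rho i (fun _ : ι → Bool => (1 : ℝ)) = 0 :=
    le_antisymm (rho_le fun σ => by simp) (rho_nonneg _ _)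
  simpa [h1] using h

/-- One step of the random-scan heat-bath dynamics applied to `f`. -/
noncomputable def heatBath (π : (ι → Bool) → ℝ) (f : (ι → Bool) → ℝ) (σ : ι → Bool) : ℝ :=
  (Fintype.card ι : ℝ)⁻¹ * ∑ i, condMean π i f σ

lemma rho_heatBath_le [Nonempty ι] {π : (ι → Bool) → ℝ} (hpos : ∀ σ, 0 < π σ)
    {Γ : Matrix ι ι ℝ} (hΓ : ∀ i j, Γ i j = if i = j then 0 else dobr π i j)
    (j : ι) (f : (ι → Bool) → ℝ) :
    rho j (heatBath π f) ≤
      rho j f + (Fintype.card ι : ℝ)⁻¹ * (∑ i, Γ i j * rho i f - rho j f) := by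
  have hn : (Fintype.card ι : ℝ) ≠ 0 := by simp
  have hstep : ∀ i, rho j (condMean π i f) ≤
      rho j f + Γ i j * rho i f - if i = j then rho j f else 0 := by
    intro i
    rw [hΓ]
    split_ifs with h
    · subst h
      simpa using rho_condMean_self π i f
    · simpa using rho_condMean_le hpos h f
  refine (rho_le (c := (Fintype.card ι : ℝ)⁻¹ * ∑ i, rho j (condMean π i f)) fun σ => ?_).trans ?_
  · rw [heatBath, heatBath, ← mul_sub, ← Finset.sum_sub_distrib, abs_mul,
      abs_of_nonneg (by positivity)]
    gcongr
    exact (Finset.abs_sum_le_sum_abs _ _).trans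
      (Finset.sum_le_sum fun i _ => abs_sub_flipAt_le_rho j _ σ)
  · calc _ ≤ (Fintype.card ι : ℝ)⁻¹ *
          ∑ i, (rho j f + Γ i j * rho i f - if i = j then rho j f else 0) := by
          gcongr with i
          exact hstep i
      _ = _ := by
          rw [Finset.sum_sub_distrib, Finset.sum_add_distrib, Finset.sum_ite_eq']
          simp only [Finset.sum_const, Finset.card_univ, nsmul_eq_mul, Finset.mem_univ, if_true]
          field_simp
          ring

lemma Cov_sub_Cov {α : Type*} [Fintype α] (π f h g : α → ℝ) :
    Cov π f g - Cov π h g =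
      Emean π (fun x => (f x - h x) * g x) - Emean π (fun x => f x - h x) * Emean π g := by
  simp only [Cov, Emean, sub_mul, mul_sub, Finset.sum_sub_distrib]
  ring

lemma abs_Cov_sub_heatBath_le [Nonempty ι] {π : (ι → Bool) → ℝ} (hpos : ∀ σ, 0 < π σ)
    (hprob : ∑ σ, π σ = 1) (f g : (ι → Bool) → ℝ) :
    |Cov π f g - Cov π (heatBath π f) g| ≤
      (Fintype.card ι : ℝ)⁻¹ * ∑ i, 1 / 4 * (rho i f * rho i g) := by
  have hn : (Fintype.card ι : ℝ) ≠ 0 := by simp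
  have hsub : ∀ σ, f σ - heatBath π f σ =
      (Fintype.card ι : ℝ)⁻¹ * ∑ i, (f σ - condMean π i f σ) := by
    intro σ
    rw [heatBath, Finset.sum_sub_distrib]
    simp only [Finset.sum_const, Finset.card_univ, nsmul_eq_mul]
    field_simp
  have hmean : ∀ h : (ι → Bool) → ℝ, Emean π (fun σ => (f σ - heatBath π f σ) * h σ) =
      (Fintype.card ι : ℝ)⁻¹ * ∑ i, Emean π fun σ => (f σ - condMean π i f σ) * h σ := by
    intro h
    simp only [Emean, hsub]
    rw [Finset.sum_comm, Finset.mul_sum]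
    refine Finset.sum_congr rfl fun σ _ => ?_
    rw [← Finset.mul_sum, ← Finset.sum_mul]
    ring
  have hzero : Emean π (fun σ => f σ - heatBath π f σ) = 0 := by
    have := hmean fun _ => 1
    simpa [Emean_condMean hpos hprob] using this
  rw [Cov_sub_Cov, hzero, zero_mul, sub_zero, hmean, abs_mul, abs_of_nonneg (by positivity)]
  gcongr
  exact (Finset.abs_sum_le_sum_abs _ _).trans
    (Finset.sum_le_sum fun i _ => abs_Emean_sub_condMean_mul_le hpos hprob i f g)

lemma abs_Cov_le_sum_rho {π : (ι → Bool) → ℝ} (hpos : ∀ σ, 0 < π σ) (hprob : ∑ σ, π σ = 1)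
    (f g : (ι → Bool) → ℝ) :
    |Cov π f g| ≤ Emean π (fun σ => |g σ|) * ∑ i, rho i f := by
  have hcenter : ∀ σ, |f σ - Emean π f| ≤ ∑ i, rho i f := by
    intro σ
    have : f σ - Emean π f = ∑ τ, π τ * (f σ - f τ) := by
      simp only [mul_sub, Finset.sum_sub_distrib, ← Finset.sum_mul, hprob, one_mul, Emean]
    rw [this]
    calc _ ≤ ∑ τ, π τ * |f σ - f τ| := by
          refine (Finset.abs_sum_le_sum_abs _ _).trans_eq (Finset.sum_congr rfl fun τ _ => ?_)
          rw [abs_mul, abs_of_pos (hpos τ)]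
      _ ≤ ∑ τ, π τ * ∑ i, rho i f := by
          gcongr with τ
          · exact (hpos τ).le
          · exact abs_sub_le_sum_rho f σ τ
      _ = _ := by rw [← Finset.sum_mul, hprob, one_mul]
  have hCov : Cov π f g = ∑ σ, π σ * (g σ * (f σ - Emean π f)) := by
    simp only [Cov, mul_sub, Finset.sum_sub_distrib]
    congr 1
    · exact Finset.sum_congr rfl fun σ _ => by ring
    · rw [mul_comm, Emean.eq_1 π g, Finset.sum_mul]
      exact Finset.sum_congr rfl fun σ _ => by ring
  rw [hCov, Emean.eq_1 π fun σ => |g σ|, Finset.sum_mul]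
  refine (Finset.abs_sum_le_sum_abs _ _).trans (Finset.sum_le_sum fun σ _ => ?_)
  rw [abs_mul, abs_mul, abs_of_pos (hpos σ), mul_assoc]
  have := (hpos σ).le
  gcongr
  exact hcenter σ

end Dobrushin

namespace Matrix

variable {ι : Type*} [Fintype ι] [DecidableEq ι] {A : Matrix ι ι ℝ}

lemma sum_pow_apply_le (hA : ∀ i j, 0 ≤ A i j) {c : ℝ} (hc : 0 ≤ c) (hrow : ∀ i, ∑ j, A i j ≤ c)
    (n : ℕ) (i : ι) : ∑ j, (A ^ n) i j ≤ c ^ n := by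
  induction n generalizing i with
  | zero => simp [one_apply]
  | succ n ih =>
    simp only [pow_succ', mul_apply]
    rw [Finset.sum_comm]
    calc _ ≤ ∑ k, A i k * c ^ n := by
          gcongr with k
          rw [← Finset.mul_sum]
          exact mul_le_mul_of_nonneg_left (ih k) (hA i k)
      _ ≤ c * c ^ n := by
          rw [← Finset.sum_mul]
          gcongr
          exact hrow i

lemma summable_pow_apply (hA : ∀ i j, 0 ≤ A i j) {c : ℝ} (hc : 0 ≤ c) (hc1 : c < 1)
    (hrow : ∀ i, ∑ j, A i j ≤ c) (i j : ι) : Summable fun n : ℕ => (A ^ n) i j := by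
  refine .of_nonneg_of_le (fun n => pow_apply_nonneg hA n i j) (fun n => ?_)
    (summable_geometric_of_lt_one hc hc1)
  exact (Finset.single_le_sum (fun k _ => pow_apply_nonneg hA n i k) (Finset.mem_univ j)).trans
    (sum_pow_apply_le hA hc hrow n i)

lemma tsum_pow_apply_eq (hs : ∀ i j, Summable fun n : ℕ => (A ^ n) i j) (i j : ι) :
    ∑' n : ℕ, (A ^ n) i j =
      (if i = j then 1 else 0) + ∑ k, A i k * ∑' n : ℕ, (A ^ n) k j := by
  rw [(hs i j).tsum_eq_zero_add]
  simp only [pow_succ', mul_apply, pow_zero, one_apply]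
  rw [Summable.tsum_finsetSum fun k _ => (hs k j).mul_left _]
  simp only [tsum_mul_left]

end Matrix

/-- Föllmer's covariance estimate, finite-volume form: if the Dobrushin
coefficients of a strictly positive probability `π` satisfy `max_i Σ_{j≠i} γ_{ij} ≤ γ < 1`,
then with `Γ` the matrix of coefficients (zero diagonal) and `D = Σ_n Γⁿ` (which converges),
`|Cov_π(f,g)| ≤ (1/4) Σ_{i,j} D_{ij} ρ_i(f) ρ_j(g)`. -/
theorem follmer_covariance_estimate {ι : Type*} [Fintype ι] [DecidableEq ι] [Nonempty ι]
    (π : (ι → Bool) → ℝ) (hpos : ∀ σ, 0 < π σ) (hprob : ∑ σ : ι → Bool, π σ = 1)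
    (γ : ℝ) (hγ : γ < 1)
    (hdob : ∀ i, ∑ j ∈ Finset.univ.erase i, dobr π i j ≤ γ)
    (Γ : Matrix ι ι ℝ) (hΓ : ∀ i j, Γ i j = if i = j then 0 else dobr π i j)
    (f g : (ι → Bool) → ℝ) :
    (∀ h k, Summable fun n : ℕ => (Γ ^ n) h k) ∧
    |Cov π f g| ≤ (1 / 4) * ∑ i, ∑ j, (∑' n : ℕ, (Γ ^ n) i j) * rho i f * rho j g := by
  have hn : (0 : ℝ) < Fintype.card ι := by exact_mod_cast Fintype.card_pos
  have hn1 : (Fintype.card ι : ℝ)⁻¹ ≤ 1 :=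
    inv_le_one_of_one_le₀ (by exact_mod_cast Fintype.card_pos)
  have hΓ0 : ∀ i j, 0 ≤ Γ i j := fun i j => by
    rw [hΓ]; split_ifs; exacts [le_rfl, dobr_nonneg π i j]
  have hrow : ∀ i, ∑ j, Γ i j ≤ γ := fun i => by
    refine le_of_eq_of_le ?_ (hdob i)
    rw [← Finset.add_sum_erase _ _ (Finset.mem_univ i), hΓ i i, if_pos rfl, zero_add]
    exact Finset.sum_congr rfl fun j hj => by rw [hΓ, if_neg (Finset.ne_of_mem_erase hj).symm]
  have hγ0 : 0 ≤ γ :=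
    (Finset.sum_nonneg fun j _ => hΓ0 (Classical.arbitrary ι) j).trans (hrow _)
  have hs := Matrix.summable_pow_apply hΓ0 hγ0 hγ hrow
  refine ⟨hs, ?_⟩
  have hD := Matrix.tsum_pow_apply_eq hs
  have hD0 : ∀ i j, 0 ≤ ∑' n : ℕ, (Γ ^ n) i j := fun i j =>
    tsum_nonneg fun n => Matrix.pow_apply_nonneg hΓ0 n i j
  set D : ι → ι → ℝ := fun i j => ∑' n : ℕ, (Γ ^ n) i j
  change ∀ i j, D i j = _ + ∑ k, Γ i k * D k j at hD
  change ∀ i j, 0 ≤ D i j at hD0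
  change |Cov π f g| ≤ 1 / 4 * ∑ i, ∑ j, D i j * rho i f * rho j g
  set c : ℝ := (Fintype.card ι : ℝ)⁻¹
  have hc0 : 0 < c := inv_pos.2 hn
  set q : ℝ := 1 - c * (1 - γ) with hq
  have hq0 : 0 ≤ q := by nlinarith
  have hq1 : q < 1 := by nlinarith
  have hcontract : ∀ f, ∑ j, rho j (heatBath π f) ≤ q * ∑ j, rho j f := by
    intro f
    have hswap : ∑ j, ∑ i, Γ i j * rho i f ≤ γ * ∑ i, rho i f := by
      rw [Finset.sum_comm, Finset.mul_sum]
      refine Finset.sum_le_sum fun i _ => ?_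
      rw [← Finset.sum_mul]
      exact mul_le_mul_of_nonneg_right (hrow i) (rho_nonneg i f)
    calc _ ≤ ∑ j, (rho j f + c * (∑ i, Γ i j * rho i f - rho j f)) :=
          Finset.sum_le_sum fun j _ => rho_heatBath_le hpos hΓ j f
      _ = ∑ j, rho j f + c * (∑ j, ∑ i, Γ i j * rho i f - ∑ j, rho j f) := by
          rw [Finset.sum_add_distrib, ← Finset.mul_sum, Finset.sum_sub_distrib]
      _ ≤ ∑ j, rho j f + c * (γ * ∑ j, rho j f - ∑ j, rho j f) := by gcongr
      _ = _ := by rw [hq]; ring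
  have hpotential : ∀ f j, ∑ i, D i j * rho i (heatBath π f) + c * rho j f ≤
      ∑ i, D i j * rho i f := by
    intro f j
    have hswap : ∑ i, D i j * ∑ k, Γ k i * rho k f = ∑ i, D i j * rho i f - rho j f := by
      have hk : ∀ k, D k j * rho k f =
          (if k = j then rho k f else 0) + ∑ i, D i j * (Γ k i * rho k f) := by
        intro k
        rw [hD k j, add_mul, Finset.sum_mul]
        congr 1
        · simp
        · exact Finset.sum_congr rfl fun i _ => by ring
      simp only [Finset.mul_sum]
      rw [Finset.sum_comm, Finset.sum_congr rfl fun k _ => hk k, Finset.sum_add_distrib]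
      simp
    calc _ ≤ ∑ i, D i j * (rho i f + c * (∑ k, Γ k i * rho k f - rho i f)) + c * rho j f := by
          gcongr with i
          · exact hD0 i j
          · exact rho_heatBath_le hpos hΓ i f
      _ = ∑ i, D i j * rho i f + c * (∑ i, D i j * ∑ k, Γ k i * rho k f - ∑ i, D i j * rho i f)
            + c * rho j f := by
          rw [← Finset.sum_sub_distrib, Finset.mul_sum, ← Finset.sum_add_distrib]
          congr 1
          exact Finset.sum_congr rfl fun i _ => by ring
      _ = _ := by rw [hswap]; ring
  have hbound : ∀ (m : ℕ) f, |Cov π f g| ≤ 1 / 4 * ∑ j, (∑ i, D i j * rho i f) * rho j g +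
      q ^ m * (Emean π (fun σ => |g σ|) * ∑ i, rho i f) := by
    have hK : 0 ≤ Emean π (fun σ => |g σ|) :=
      Finset.sum_nonneg fun σ _ => mul_nonneg (hpos σ).le (abs_nonneg _)
    intro m
    induction m with
    | zero =>
      intro f
      have h1 := abs_Cov_le_sum_rho hpos hprob f g
      have h2 : 0 ≤ ∑ j, (∑ i, D i j * rho i f) * rho j g :=
        Finset.sum_nonneg fun j _ => mul_nonneg
          (Finset.sum_nonneg fun i _ => mul_nonneg (hD0 i j) (rho_nonneg i f)) (rho_nonneg j g)
      linarith
    | succ m ih =>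
      intro f
      have h1 := abs_Cov_sub_heatBath_le hpos hprob f g
      have h2 := ih (heatBath π f)
      have h3 : q ^ m * (Emean π (fun σ => |g σ|) * ∑ i, rho i (heatBath π f)) ≤
          q ^ (m + 1) * (Emean π (fun σ => |g σ|) * ∑ i, rho i f) := by
        calc _ ≤ q ^ m * (Emean π (fun σ => |g σ|) * (q * ∑ i, rho i f)) := by
              gcongr
              exact hcontract f
          _ = _ := by ring
      have h4 : ∑ j, (∑ i, D i j * rho i (heatBath π f)) * rho j g +
          c * ∑ j, rho j f * rho j g ≤ ∑ j, (∑ i, D i j * rho i f) * rho j g := by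
        rw [Finset.mul_sum, ← Finset.sum_add_distrib]
        refine Finset.sum_le_sum fun j _ => ?_
        have := mul_le_mul_of_nonneg_right (hpotential f j) (rho_nonneg j g)
        linarith
      have h5 := abs_sub_abs_le_abs_sub (Cov π f g) (Cov π (heatBath π f) g)
      rw [← Finset.mul_sum] at h1
      linarith
  have hlim := ((tendsto_pow_atTop_nhds_zero_of_lt_one hq0 hq1).mul_const
    (Emean π (fun σ => |g σ|) * ∑ i, rho i f)).const_add
    (1 / 4 * ∑ j, (∑ i, D i j * rho i f) * rho j g)
  refine (ge_of_tendsto' hlim fun m => hbound m f).trans_eq ?_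
  rw [zero_mul, add_zero, Finset.sum_comm]
  simp only [Finset.sum_mul]
end

section
/- The PCA weights factorize over the Gibbs weights: for every σ ∈ {−1,1}^V, Z_σ = Σ_τ e^{−H(σ,τ)} = e^{−H(σ)} Π_{i∈V}(1 + δ φ_i(σ)) = w^G(σ) f(σ), where δ = e^{−2q}. Consequently, π^{PCA}(σ) = π^G(σ) f(σ)/π^G(f) for all σ. -/
open Finset

/-- A single-site factor of `Z_σ`: summing out one spin of the new configuration. -/
theorem sum_site_exp (a q : ℝ) (b : Bool) :
    ∑ t : Bool, Real.exp (-(-a * spin t + q * (1 - spin b * spin t))) =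
      Real.exp (a * spin b) * (1 + Real.exp (-2 * q) * Real.exp (-2 * (a * spin b))) := by
  rw [mul_add, mul_one, ← Real.exp_add, ← Real.exp_add, Fintype.sum_bool]
  cases b
  · rw [add_comm]
    congr 2 <;> simp [spin]
    ring
  · congr 2 <;> simp [spin]
    ring

/-- `Z_σ` is the Gibbs weight of `σ` times `f_δ(σ)` with `δ = e^{-2q}`. -/
theorem Zconf_eq_exp_mul_fδ {ι : Type*} [Fintype ι] [DecidableEq ι]
    (J : ι → ι → ℝ) (q : ℝ) (σ : ι → Bool) :
    Zconf J q σ = Real.exp (-Ham J σ) * fδ J (Real.exp (-2 * q)) σ := by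
  have hlocal (i : ι) : ∑ j, J i j * spin (σ i) * spin (σ j) =
      (∑ j, J i j * spin (σ j)) * spin (σ i) := by
    rw [Finset.sum_mul]
    exact Finset.sum_congr rfl fun j _ => by ring
  simp only [Zconf, Hpair, hfun, Ham, fδ, phi, hlocal, neg_neg, Real.exp_sum,
    ← Finset.prod_mul_distrib, ← sum_site_exp, ← Finset.sum_neg_distrib]
  rw [Fintype.prod_sum]

/-- Normalizing the weights `w f` agrees with tilting the normalized measure by `f`. -/
theorem mul_div_sum_eq_tilt {α : Type*} [Fintype α] (w f : α → ℝ) (hw : ∑ y, w y ≠ 0) (x : α) :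
    w x * f x / ∑ y, w y * f y =
      w x / (∑ y, w y) * f x / Emean (fun z => w z / ∑ y, w y) f := by
  have hmean : Emean (fun z => w z / ∑ y, w y) f = (∑ y, w y * f y) / ∑ y, w y := by
    rw [Emean, Finset.sum_div]
    exact Finset.sum_congr rfl fun z _ => by ring
  rw [hmean, div_mul_eq_mul_div, div_div_div_cancel_right₀ hw]

/-- The PCA weights factorize over the Gibbs weights:
`Z_σ = e^{-H(σ)} Π_i (1 + δ φ_i(σ))`, and consequently
`π^{PCA}(σ) = π^G(σ) f(σ) / π^G(f)`. -/
theorem pca_weight_factorization {ι : Type*} [Fintype ι] [DecidableEq ι] [Nonempty ι]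
    (J : ι → ι → ℝ) (hsym : ∀ i j, J i j = J j i) (hdiag : ∀ i, J i i = 0)
    (q : ℝ) (hq : 0 ≤ q) (δ : ℝ) (hδ : δ = Real.exp (-2 * q)) :
    (∀ σ : ι → Bool, Zconf J q σ = Real.exp (-Ham J σ) * fδ J δ σ) ∧
    (∀ σ : ι → Bool, piPCAq J q σ = piPCA J δ σ) := by
  subst hδ
  refine ⟨Zconf_eq_exp_mul_fδ J q, fun σ => ?_⟩
  simp only [piPCAq, Zconf_eq_exp_mul_fδ]
  refine mul_div_sum_eq_tilt (fun τ => Real.exp (-Ham J τ)) _ (ne_of_gt ?_) σ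
  exact Finset.sum_pos (fun τ _ => Real.exp_pos _) Finset.univ_nonempty
end

section
/- For y ∈ ℝ define g_y : ℝ → ℝ by g_y(x) = e^{−x}/(2 cosh x) − e^{−x−y}/(2 cosh(x+y)). Then for all x ∈ ℝ, g_y(x)² ≤ tanh²(y/2), with equality attained at x = −y/2; in particular |g_y(x)| ≤ |tanh(y/2)| for all x, y ∈ ℝ. -/
open Finset

/-- `g_y(x) = e^{-x}/(2 cosh x) - e^{-x-y}/(2 cosh(x+y))`. -/
noncomputable def gdiff (y x : ℝ) : ℝ :=
  Real.exp (-x) / (2 * Real.cosh x) - Real.exp (-x - y) / (2 * Real.cosh (x + y))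

/-- In the symmetric variable `u = x + y / 2`, `g_y` is `tanh (y / 2)` times a factor which is
at most `1` and equals `1` at `u = 0`. -/
lemma gdiff_eq_tanh_mul (y x : ℝ) :
    gdiff y x = Real.tanh (y / 2) *
      (Real.cosh (y / 2) ^ 2 / (Real.cosh (y / 2) ^ 2 + Real.sinh (x + y / 2) ^ 2)) := by
  obtain ⟨a, rfl⟩ : ∃ a, y = 2 * a := ⟨y / 2, by ring⟩
  obtain ⟨u, rfl⟩ : ∃ u, x = u - a := ⟨x + a, by ring⟩
  have hx : u - a + 2 * a = u + a := by ring
  have hy : 2 * a / 2 = a := by ring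
  have hn : -(u - a) - 2 * a = -(u + a) := by ring
  have hprod : Real.cosh (u - a) * Real.cosh (u + a) =
      Real.cosh a ^ 2 + Real.sinh u ^ 2 := by
    rw [Real.cosh_sub, Real.cosh_add]
    linear_combination Real.cosh a ^ 2 * Real.cosh_sq u - Real.sinh u ^ 2 * Real.sinh_sq a
  have hm := (Real.cosh_pos (u - a)).ne'
  have hp := (Real.cosh_pos (u + a)).ne'
  have ha := (Real.cosh_pos a).ne'
  rw [gdiff, hx, hy, hn, sub_add_cancel, ← hprod, Real.tanh_eq_sinh_div_cosh,
    ← Real.cosh_sub_sinh (u - a), ← Real.cosh_sub_sinh (u + a)]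
  have hsinh : Real.sinh (u + a) * Real.cosh (u - a) - Real.cosh (u + a) * Real.sinh (u - a) =
      2 * (Real.sinh a * Real.cosh a) := by
    rw [← Real.sinh_sub, ← mul_assoc, ← Real.sinh_two_mul]
    congr 1
    ring
  field_simp
  linear_combination hsinh

lemma abs_gdiff_le_abs_tanh (y x : ℝ) : |gdiff y x| ≤ |Real.tanh (y / 2)| := by
  have hc := Real.cosh_pos (y / 2)
  rw [gdiff_eq_tanh_mul, abs_mul]
  refine mul_le_of_le_one_right (abs_nonneg _) ?_
  rw [abs_of_nonneg (by positivity)]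
  exact div_le_one_of_le₀ (le_add_of_nonneg_right (sq_nonneg _)) (by positivity)

lemma gdiff_neg_half (y : ℝ) : gdiff y (-y / 2) = Real.tanh (y / 2) := by
  have hc := (Real.cosh_pos (y / 2)).ne'
  rw [gdiff_eq_tanh_mul, show -y / 2 + y / 2 = 0 by ring]
  simp [hc]

/-- For all `x`, `g_y(x)² ≤ tanh²(y/2)`, with equality at `x = -y/2`;
in particular `|g_y(x)| ≤ |tanh(y/2)|`. -/
theorem gdiff_sq_le_tanh_sq (y : ℝ) :
    (∀ x : ℝ, (gdiff y x) ^ 2 ≤ (Real.tanh (y / 2)) ^ 2) ∧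
    (gdiff y (-y / 2)) ^ 2 = (Real.tanh (y / 2)) ^ 2 ∧
    (∀ x : ℝ, |gdiff y x| ≤ |Real.tanh (y / 2)|) := by
  exact ⟨fun x => sq_le_sq.mpr (abs_gdiff_le_abs_tanh y x), by rw [gdiff_neg_half],
    abs_gdiff_le_abs_tanh y⟩
end
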